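/- arXiv:1209.4215 — 6 statements merged into one kernel-verified Lean document; each statement's English description precedes it below -/
import Mathlib

section
/- Let (S, 𝔪) be a commutative noetherian local ring, let Γ be an S-algebra that is finitely generated as an S-module, and let X and Y be finitely generated left Γ-modules with X ≠ 0. If Y has finite injective dimension d as a left Γ-module and i is an integer with i > d − depth_S X, then Ext^i_Γ(X, Y) = 0. -/
/-!
Statement 0: Let (S, 𝔪) be a commutative noetherian local ring, Γ an S-algebra that is
finitely generated as an S-module, and X, Y finitely generated left Γ-modules with X ≠ 0.
If Y has finite injective dimension d as a left Γ-module and i > d − depth_S X, then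
Ext^i_Γ(X, Y) = 0.
-/

open CategoryTheory

/-- The `i`-th Ext group of two left modules over a (possibly noncommutative) ring `Γ`,
computed in the abelian category of left `Γ`-modules. -/
noncomputable def extGroup (Γ : Type) [Ring Γ] (n : ℕ) (X Y : ModuleCat Γ) : ModuleCat ℤ :=
  ((Ext ℤ (ModuleCat Γ) n).obj (Opposite.op X)).obj Y

/-- The depth of a module `X` over a commutative noetherian local ring `S`: the least `i`
such that `Ext^i_S(S/𝔪, X) ≠ 0` (as an element of `ℕ∞`, with `⊤` if there is no such `i`). -/
noncomputable def moduleDepth (S : Type) [CommRing S] [IsLocalRing S] (X : ModuleCat S) : ℕ∞ :=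
  sInf {i : ℕ∞ | ∃ n : ℕ, i = (n : ℕ∞) ∧
    Nontrivial (extGroup S n (ModuleCat.of S (S ⧸ IsLocalRing.maximalIdeal S)) X)}

/-- A left `Γ`-module `Y` has injective dimension at most `n` if it admits an injective
resolution which vanishes in degrees `> n`. -/
def hasInjDimLE (Γ : Type) [Ring Γ] (Y : ModuleCat Γ) (n : ℕ) : Prop :=
  ∃ I : InjectiveResolution Y, ∀ k, n < k → Limits.IsZero (I.cocomplex.X k)

lemma aux_subsingleton_iff (Γ : Type) [Ring Γ] (n : ℕ) (X Y : ModuleCat Γ)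
    (P : ProjectiveResolution X) :
    Subsingleton (extGroup Γ n X Y) ↔ (P.complex.linearYonedaObj ℤ Y).ExactAt n := by
  rw [HomologicalComplex.exactAt_iff_isZero_homology, ← (P.isoExt n Y).isZero_iff,
    ModuleCat.isZero_iff_subsingleton]
  rfl

lemma aux_succ (Γ : Type) [Ring Γ] (n : ℕ) (X Y : ModuleCat Γ) :
    Subsingleton (extGroup Γ (n + 1) X Y) ↔ Subsingleton (Abelian.Ext X Y (n + 1)) := by
  let P := projectiveResolution X
  rw [aux_subsingleton_iff Γ _ X Y P,
    HomologicalComplex.exactAt_iff' _ n (n + 1) (n + 2) (by simp) (by simp),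
    ShortComplex.moduleCat_exact_iff]
  constructor
  · intro h
    refine subsingleton_of_forall_eq 0 fun α => ?_
    obtain ⟨f, hf, rfl⟩ := P.extMk_surjective α (n + 2) rfl
    rw [P.extMk_eq_zero_iff f _ rfl hf n rfl]
    exact h f hf
  · intro h f hf
    have := (P.extMk_eq_zero_iff f (n + 2) rfl hf n rfl).1 (Subsingleton.elim _ _)
    exact this

lemma aux_zero (Γ : Type) [Ring Γ] (X Y : ModuleCat Γ)
    (h : Subsingleton (extGroup Γ 0 X Y)) : Subsingleton (Abelian.Ext X Y 0) := by
  let P := projectiveResolution X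
  rw [aux_subsingleton_iff Γ _ X Y P,
    HomologicalComplex.exactAt_iff' _ 0 0 1 (by simp) (by simp),
    ShortComplex.moduleCat_exact_iff] at h
  rw [Abelian.Ext.addEquiv₀.subsingleton_congr]
  refine subsingleton_of_forall_eq 0 fun g => ?_
  let p : P.complex.X 0 ⟶ X := P.π.f 0 ≫ (HomologicalComplex.singleObjXSelf _ _ _).hom
  have hp : Epi p := by infer_instance
  have hd0 : P.complex.d 1 0 ≫ P.π.f 0 = 0 := P.complex_d_comp_π_f_zero
  have hd : P.complex.d 1 0 ≫ p = 0 := by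
    simp only [p]
    rw [reassoc_of% hd0, Limits.zero_comp]
  obtain ⟨(q : P.complex.X 0 ⟶ Y), hq⟩ := h (p ≫ g) (by
    change P.complex.d 1 0 ≫ p ≫ g = 0
    rw [reassoc_of% hd, Limits.zero_comp])
  have hq' : P.complex.d 0 0 ≫ q = p ≫ g := hq
  rw [P.complex.shape 0 0 (by simp), Limits.zero_comp] at hq'
  rw [← cancel_epi p, ← hq', Limits.comp_zero]

lemma aux_inj (Γ : Type) [Ring Γ] (X Y : ModuleCat Γ) (d : ℕ) (h : hasInjDimLE Γ Y d)
    (i : ℕ) (hi : d < i) : Subsingleton (Abelian.Ext X Y i) := by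
  obtain ⟨I, hI⟩ := h
  refine subsingleton_of_forall_eq 0 fun α => ?_
  obtain ⟨f, hf, rfl⟩ := I.extMk_surjective α (i + 1) rfl
  obtain rfl := (hI i hi).eq_of_tgt f 0
  exact I.extMk_zero _ _

/-- S-linear structure on the category of modules over an `S`-algebra. -/
@[reducible]
noncomputable def auxLinear (S : Type) [CommRing S] (Γ : Type) [Ring Γ] [Algebra S Γ] :
    Linear S (ModuleCat.{0} Γ) :=
  letI (M : ModuleCat.{0} Γ) : Module S M := Module.restrictScalars S Γ M
  haveI (M : ModuleCat.{0} Γ) : IsScalarTower S Γ M := IsScalarTower.restrictScalars S Γ M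
  { homModule := fun _ _ => inferInstance }

lemma auxLinear_smul_apply (S : Type) [CommRing S] (Γ : Type) [Ring Γ] [Algebra S Γ]
    (M N : ModuleCat.{0} Γ) (f : M ⟶ N) (s : S) (x : M) :
    letI := auxLinear S Γ
    (s • f).hom x = algebraMap S Γ s • f.hom x := rfl

lemma aux_finite_hom (S : Type) [CommRing S] [IsNoetherianRing S] (Γ : Type) [Ring Γ]
    [Algebra S Γ] [Module.Finite S Γ] (M N : ModuleCat.{0} Γ) [Module.Finite Γ M]
    [Module.Finite Γ N] :
    letI := auxLinear S Γ
    Module.Finite S (M ⟶ N) := by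
  letI := auxLinear S Γ
  letI (M : ModuleCat.{0} Γ) : Module S M := Module.restrictScalars S Γ M
  haveI (M : ModuleCat.{0} Γ) : IsScalarTower S Γ M := IsScalarTower.restrictScalars S Γ M
  haveI : Module.Finite S M := Module.Finite.trans Γ M
  haveI : Module.Finite S N := Module.Finite.trans Γ N
  let φ : (M ⟶ N) →ₗ[S] (M →ₗ[S] N) :=
    { toFun f := f.hom.restrictScalars S
      map_add' _ _ := rfl
      map_smul' _ _ := rfl }
  refine Module.Finite.of_injective φ ?_
  intro f g h
  ext x
  exact LinearMap.congr_fun h x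

lemma aux_finite_ext (S : Type) [CommRing S] [IsNoetherianRing S] (Γ : Type) [Ring Γ]
    [Algebra S Γ] [Module.Finite S Γ] (i : ℕ) (M N : ModuleCat.{0} Γ) [Module.Finite Γ M]
    [Module.Finite Γ N] :
    letI := auxLinear S Γ
    Module.Finite S (Abelian.Ext M N i) := by
  letI := auxLinear S Γ
  haveI : IsNoetherianRing Γ := by
    haveI : IsNoetherian S Γ := inferInstance
    exact isNoetherian_of_tower S inferInstance
  induction i generalizing M with
  | zero =>
    haveI := aux_finite_hom S Γ M N
    exact Module.Finite.equiv (Abelian.Ext.linearEquiv₀ (R := S) (X := M) (Y := N)).symm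
  | succ n ih =>
    obtain ⟨m, f, surjf⟩ := Module.Finite.exists_fin' Γ M
    haveI : Projective f.shortComplexKer.X₂ :=
      inferInstanceAs (Projective (ModuleCat.of Γ (Fin m → Γ)))
    let exac := LinearMap.shortExact_shortComplexKer surjf
    haveI := ih f.shortComplexKer.X₁
    exact Module.Finite.of_surjective (exac.extClass.precompOfLinear S N (add_comm 1 n))
      (precomp_extClass_surjective_of_projective_X₂ N exac n)

lemma aux_comp (S : Type) [CommRing S] (Γ : Type) [Ring Γ]
    [Algebra S Γ] (i : ℕ) (M N : ModuleCat.{0} Γ) (f : M ⟶ M) (s : S)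
    (hf : ∀ x : M, f.hom x = algebraMap S Γ s • x) (y : Abelian.Ext M N i) :
    letI := auxLinear S Γ
    (Abelian.Ext.mk₀ f).comp y (zero_add i) = s • y := by
  letI := auxLinear S Γ
  have h : f = s • 𝟙 M := by
    ext x
    exact hf x
  rw [h, Abelian.Ext.mk₀_smul, Abelian.Ext.smul_comp, Abelian.Ext.mk₀_id_comp]

open scoped Pointwise in
lemma aux_main (S : Type) [CommRing S] [IsNoetherianRing S] [IsLocalRing S]
    (Γ : Type) [Ring Γ] [Algebra S Γ] [Module.Finite S Γ]
    (Y : ModuleCat.{0} Γ) [Module.Finite Γ Y] (d : ℕ) (hinj : hasInjDimLE Γ Y d)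
    (rs : List S) (hrs : ∀ r ∈ rs, r ∈ IsLocalRing.maximalIdeal S)
    (X : Type) [AddCommGroup X] [Module Γ X] [Module S X] [IsScalarTower S Γ X]
    [Module.Finite Γ X] (hreg : RingTheory.Sequence.IsWeaklyRegular X rs)
    (i : ℕ) (hi : d < i + rs.length) :
    Subsingleton (Abelian.Ext (ModuleCat.of Γ X) Y i) := by
  induction rs generalizing X i with
  | nil => exact aux_inj Γ _ Y d hinj i (by simpa using hi)
  | cons r rs ih =>
    rw [RingTheory.Sequence.isWeaklyRegular_cons_iff] at hreg
    obtain ⟨hr, hreg⟩ := hreg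
    haveI : SMulCommClass S Γ X := IsScalarTower.to_smulCommClass
    let φ : X →ₗ[Γ] X :=
      { toFun x := r • x
        map_add' := smul_add r
        map_smul' g x := smul_comm r g x }
    let Q := X ⧸ LinearMap.range φ
    have hQ : (LinearMap.range φ).restrictScalars S = r • (⊤ : Submodule S X) := by
      ext x
      simp [Submodule.mem_smul_pointwise_iff_exists, φ]
    let e : QuotSMulTop r X ≃ₗ[S] Q :=
      (Submodule.quotEquivOfEq _ _ hQ.symm).trans (Submodule.Quotient.restrictScalarsEquiv S _)
    have h1 := ih (fun s hs => hrs s (List.mem_cons_of_mem _ hs)) Q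
      ((e.isWeaklyRegular_congr rs).1 hreg) (1 + i) (by simp at hi; omega)
    have hex : Function.Exact φ (LinearMap.range φ).mkQ := LinearMap.exact_map_mkQ_range φ
    let T : ShortComplex (ModuleCat.{0} Γ) :=
      ModuleCat.shortComplexOfCompEqZero φ (LinearMap.range φ).mkQ hex.linearMap_comp_eq_zero
    have hT : T.ShortExact :=
      { exact := ModuleCat.shortComplex_exact _ hex
        mono_f := by
          rw [ModuleCat.mono_iff_injective]
          exact hr
        epi_g := by
          rw [ModuleCat.epi_iff_surjective]
          exact Submodule.mkQ_surjective _ }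
    letI := auxLinear S Γ
    haveI := aux_finite_ext S Γ i (ModuleCat.of Γ X) Y
    have hsurj : ∀ x : Abelian.Ext (ModuleCat.of Γ X) Y i,
        ∃ y : Abelian.Ext (ModuleCat.of Γ X) Y i, r • y = x := by
      intro x
      obtain ⟨y, hy⟩ := Abelian.Ext.contravariant_sequence_exact₁ hT Y x rfl
        (Subsingleton.elim (α := Abelian.Ext (ModuleCat.of Γ Q) Y (1 + i)) _ _)
      refine ⟨y, ?_⟩
      rw [← hy]
      exact (aux_comp S Γ i (ModuleCat.of Γ X) Y T.f r
        (fun x => (algebraMap_smul Γ r x).symm) y).symm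
    have hbot : (⊤ : Submodule S (Abelian.Ext (ModuleCat.of Γ X) Y i)) = ⊥ := by
      refine Submodule.eq_bot_of_le_smul_of_le_jacobson_bot (IsLocalRing.maximalIdeal S) _
        Module.Finite.fg_top ?_ (IsLocalRing.maximalIdeal_le_jacobson _)
      intro x _
      obtain ⟨y, rfl⟩ := hsurj x
      exact Submodule.smul_mem_smul (hrs r List.mem_cons_self) trivial
    exact (Submodule.subsingleton_iff S).1 (subsingleton_of_bot_eq_top hbot.symm)

lemma aux_regular (S : Type) [CommRing S] [IsNoetherianRing S] [IsLocalRing S]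
    (X : Type) [AddCommGroup X] [Module S X] [Module.Finite S X] [Nontrivial X] (n : ℕ)
    (hn : (n : ℕ∞) ≤ moduleDepth S (ModuleCat.of S X)) :
    ∃ rs : List S, rs.length = n ∧ (∀ r ∈ rs, r ∈ IsLocalRing.maximalIdeal S) ∧
      RingTheory.Sequence.IsRegular X rs := by
  have hlt : IsLocalRing.maximalIdeal S • (⊤ : Submodule S X) < ⊤ := by
    refine lt_top_iff_ne_top.2 (Ne.symm ?_)
    exact Submodule.top_ne_ideal_smul_of_le_jacobson_annihilator
      (IsLocalRing.maximalIdeal_le_jacobson _)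
  refine ModuleCat.exists_isRegular_of_exists_subsingleton_ext (IsLocalRing.maximalIdeal S) n
    (ModuleCat.of S X) hlt (ModuleCat.of S (S ⧸ IsLocalRing.maximalIdeal S)) ?_ ?_
  · rw [Module.support_eq_zeroLocus, Ideal.annihilator_quotient]
  · intro j hj
    have h : Subsingleton (extGroup S j
        (ModuleCat.of S (S ⧸ IsLocalRing.maximalIdeal S)) (ModuleCat.of S X)) := by
      by_contra hc
      rw [not_subsingleton_iff_nontrivial] at hc
      have h2 : moduleDepth S (ModuleCat.of S X) ≤ (j : ℕ∞) := sInf_le ⟨j, rfl, hc⟩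
      have h3 := hn.trans h2
      rw [Nat.cast_le] at h3
      omega
    cases j with
    | zero => exact aux_zero S _ _ h
    | succ j => exact (aux_succ S j _ _).1 h

theorem ext_vanishing_above_injdim_minus_depth
    (S : Type) [CommRing S] [IsNoetherianRing S] [IsLocalRing S]
    (Γ : Type) [Ring Γ] [Algebra S Γ] [Module.Finite S Γ]
    (X Y : Type) [AddCommGroup X] [Module Γ X] [Module S X] [IsScalarTower S Γ X]
    [AddCommGroup Y] [Module Γ Y]
    [Module.Finite Γ X] [Module.Finite Γ Y]
    [Nontrivial X]
    (d : ℕ)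
    -- `Y` has finite injective dimension exactly `d` as a left `Γ`-module:
    (hinj : hasInjDimLE Γ (ModuleCat.of Γ Y) d)
    (hmin : ∀ m : ℕ, hasInjDimLE Γ (ModuleCat.of Γ Y) m → d ≤ m)
    (i : ℕ) (hi : (d : ℕ∞) - moduleDepth S (ModuleCat.of S X) < (i : ℕ∞)) :
    Subsingleton (extGroup Γ i (ModuleCat.of Γ X) (ModuleCat.of Γ Y)) := by
  haveI : Module.Finite S X := Module.Finite.trans Γ X
  obtain ⟨n, hn, hdi⟩ : ∃ n : ℕ, (n : ℕ∞) ≤ moduleDepth S (ModuleCat.of S X) ∧ d < i + n := by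
    generalize moduleDepth S (ModuleCat.of S X) = δ at hi ⊢
    induction δ using ENat.recTopCoe with
    | top =>
      have : 0 < i := Nat.pos_of_ne_zero (by rintro rfl; simp at hi)
      exact ⟨d, le_top, by omega⟩
    | coe m =>
      refine ⟨m, le_rfl, ?_⟩
      rw [← ENat.natCast_sub, Nat.cast_lt] at hi
      omega
  obtain ⟨rs, hlen, hmem, hreg⟩ := aux_regular S X n hn
  have hpos : i ≠ 0 := by
    rintro rfl
    simp at hi
  obtain ⟨j, rfl⟩ := Nat.exists_eq_succ_of_ne_zero hpos
  exact (aux_succ Γ j _ _).2 (aux_main S Γ (ModuleCat.of Γ Y) d hinj rs hmem X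
    hreg.toIsWeaklyRegular _ (by omega))
end

section
/- Let A be a noetherian ring whose global dimension is at most n, let e ∈ A be an idempotent, and let E = eAe. Then every finitely generated left E-module X admits an exact sequence 0 → Q_n → Q_{n−1} → ⋯ → Q_1 → Q_0 → X → 0 of left E-modules in which each Q_i is a direct summand of a finite direct sum of copies of the left E-module eA. -/
set_option maxHeartbeats 1000000 in
def Corner {A : Type} [Ring A] (e : A) (_he : IsIdempotentElem e) : Type :=
  {x : A // e * x = x ∧ x * e = x}

namespace Corner

variable {A : Type} [Ring A] {e : A} {he : IsIdempotentElem e}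

set_option maxHeartbeats 1000000 in
instance : Ring (Corner e he) where
  add x y := ⟨x.1 + y.1, by rw [mul_add, x.2.1, y.2.1], by rw [add_mul, x.2.2, y.2.2]⟩
  add_assoc x y z := Subtype.ext (add_assoc _ _ _)
  zero := ⟨0, by simp, by simp⟩
  zero_add x := Subtype.ext (zero_add _)
  add_zero x := Subtype.ext (add_zero _)
  add_comm x y := Subtype.ext (add_comm _ _)
  mul x y := ⟨x.1 * y.1, by rw [← mul_assoc, x.2.1], by rw [mul_assoc, y.2.2]⟩
  left_distrib x y z := Subtype.ext (mul_add _ _ _)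
  right_distrib x y z := Subtype.ext (add_mul _ _ _)
  zero_mul x := Subtype.ext (zero_mul _)
  mul_zero x := Subtype.ext (mul_zero _)
  mul_assoc x y z := Subtype.ext (mul_assoc _ _ _)
  one := ⟨e, he, he⟩
  one_mul x := Subtype.ext x.2.1
  mul_one x := Subtype.ext x.2.2
  neg x := ⟨-x.1, by rw [mul_neg, x.2.1], by rw [neg_mul, x.2.2]⟩
  neg_add_cancel x := Subtype.ext (neg_add_cancel _)
  nsmul n x := ⟨n • x.1, by rw [mul_smul_comm, x.2.1], by rw [smul_mul_assoc, x.2.2]⟩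
  nsmul_zero x := Subtype.ext (zero_nsmul _)
  nsmul_succ n x := Subtype.ext (succ_nsmul _ _)
  zsmul n x := ⟨n • x.1, by rw [mul_smul_comm, x.2.1], by rw [smul_mul_assoc, x.2.2]⟩
  zsmul_zero' x := Subtype.ext (zero_zsmul _)
  zsmul_succ' n x := Subtype.ext
    (show ((n.succ : ℕ) : ℤ) • x.1 = ((n : ℕ) : ℤ) • x.1 + x.1 by
      push_cast; rw [add_zsmul, one_zsmul])
  zsmul_neg' n x := Subtype.ext
    (show (Int.negSucc n) • x.1 = -(((n.succ : ℕ) : ℤ) • x.1) by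
      rw [negSucc_zsmul, natCast_zsmul])
  natCast n := ⟨n • e, by rw [mul_smul_comm, he.eq], by rw [smul_mul_assoc, he.eq]⟩
  natCast_zero := Subtype.ext (zero_nsmul _)
  natCast_succ n := Subtype.ext (succ_nsmul _ _)
  intCast n := ⟨n • e, by rw [mul_smul_comm, he.eq], by rw [smul_mul_assoc, he.eq]⟩
  intCast_ofNat n := Subtype.ext (natCast_zsmul _ _)
  intCast_negSucc n := Subtype.ext (negSucc_zsmul _ _)

end Corner

def eASubgroup (A : Type) [Ring A] (e : A) : AddSubgroup A where
  carrier := {a : A | e * a = a}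
  add_mem' := by intro a b ha hb; simp only [Set.mem_setOf_eq] at *; rw [mul_add, ha, hb]
  zero_mem' := by simp
  neg_mem' := by intro a ha; simp only [Set.mem_setOf_eq] at *; rw [mul_neg, ha]

instance eASubgroup.instModule {A : Type} [Ring A] {e : A} {he : IsIdempotentElem e} :
    Module (Corner e he) (eASubgroup A e) where
  smul x a := ⟨x.1 * a.1, show e * (x.1 * a.1) = x.1 * a.1 by rw [← mul_assoc, x.2.1]⟩
  one_smul a := Subtype.ext (show e * a.1 = a.1 from a.2)
  mul_smul x y a := Subtype.ext (mul_assoc _ _ _)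
  smul_zero x := Subtype.ext (mul_zero _)
  smul_add x a b := Subtype.ext (mul_add _ _ _)
  add_smul x y a := Subtype.ext (add_mul _ _ _)
  zero_smul a := Subtype.ext (zero_mul _)

def AeSubgroup (A : Type) [Ring A] (e : A) : AddSubgroup A where
  carrier := {a : A | a * e = a}
  add_mem' := by intro a b ha hb; simp only [Set.mem_setOf_eq] at *; rw [add_mul, ha, hb]
  zero_mem' := by simp
  neg_mem' := by intro a ha; simp only [Set.mem_setOf_eq] at *; rw [neg_mul, ha]

instance AeSubgroup.instModule {A : Type} [Ring A] {e : A} {he : IsIdempotentElem e} :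
    Module (Corner e he)ᵐᵒᵖ (AeSubgroup A e) where
  smul x a := ⟨a.1 * x.unop.1,
    show (a.1 * x.unop.1) * e = a.1 * x.unop.1 by rw [mul_assoc, x.unop.2.2]⟩
  one_smul a := Subtype.ext (show a.1 * e = a.1 from a.2)
  mul_smul x y a := Subtype.ext (mul_assoc _ _ _).symm
  smul_zero x := Subtype.ext (zero_mul _)
  smul_add x a b := Subtype.ext (add_mul _ _ _)
  add_smul x y a := Subtype.ext (mul_add _ _ _)
  zero_smul a := Subtype.ext (mul_zero _)

open CategoryTheory

/-- A left `A`-module `M` has projective dimension at most `n` if it admits a projective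
resolution which vanishes in degrees `> n`. -/
def hasProjDimLE (A : Type) [Ring A] (M : ModuleCat A) (n : ℕ) : Prop :=
  ∃ P : ProjectiveResolution M, ∀ k, n < k → Limits.IsZero (P.complex.X k)


def ePart {A : Type} [Ring A] (e : A) (M : Type) [AddCommGroup M] [Module A M] : AddSubgroup M where
  carrier := {m : M | e • m = m}
  add_mem' := by intro a b ha hb; simp only [Set.mem_setOf_eq] at *; rw [smul_add, ha, hb]
  zero_mem' := by simp
  neg_mem' := by intro a ha; simp only [Set.mem_setOf_eq] at *; rw [smul_neg, ha]

instance ePart.instModule {A : Type} [Ring A] {e : A} {he : IsIdempotentElem e}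
    {M : Type} [AddCommGroup M] [Module A M] :
    Module (Corner e he) (ePart e M) where
  smul x a := ⟨x.1 • a.1, show e • (x.1 • a.1) = x.1 • a.1 by rw [← mul_smul, x.2.1]⟩
  one_smul a := Subtype.ext (show e • a.1 = a.1 from a.2)
  mul_smul x y a := Subtype.ext (mul_smul x.1 y.1 a.1)
  smul_zero x := Subtype.ext (smul_zero _)
  smul_add x a b := Subtype.ext (smul_add _ _ _)
  add_smul x y a := Subtype.ext (add_smul x.1 y.1 a.1)
  zero_smul a := Subtype.ext (zero_smul A a.1)

def ePart.map {A : Type} [Ring A] {e : A} (he : IsIdempotentElem e)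
    {M N : Type} [AddCommGroup M] [Module A M] [AddCommGroup N] [Module A N] (f : M →ₗ[A] N) :
    ePart e M →ₗ[Corner e he] ePart e N where
  toFun m := ⟨f m.1, show e • f m.1 = f m.1 by
    rw [← map_smul, show e • m.1 = m.1 from m.2]⟩
  map_add' a b := Subtype.ext (map_add f _ _)
  map_smul' x a := Subtype.ext (map_smul f x.1 a.1)

def ePart.toPi {A : Type} [Ring A] {e : A} (he : IsIdempotentElem e) (m : ℕ) :
    ePart e (Fin m → A) →ₗ[Corner e he] (Fin m → eASubgroup A e) where
  toFun v := fun i => ⟨v.1 i, congrFun (show e • v.1 = v.1 from v.2) i⟩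
  map_add' a b := rfl
  map_smul' x a := rfl

def ePart.ofPi {A : Type} [Ring A] {e : A} (he : IsIdempotentElem e) (m : ℕ) :
    (Fin m → eASubgroup A e) →ₗ[Corner e he] ePart e (Fin m → A) where
  toFun v := ⟨fun i => (v i).1, funext fun i => (v i).2⟩
  map_add' a b := rfl
  map_smul' x a := rfl

theorem ePart_summand {A : Type} [Ring A] {e : A} (he : IsIdempotentElem e)
    (P : Type) [AddCommGroup P] [Module A P] [Module.Finite A P] [Module.Projective A P] :
    ∃ (m : ℕ) (ι : ePart e P →ₗ[Corner e he] (Fin m → eASubgroup A e))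
        (π : (Fin m → eASubgroup A e) →ₗ[Corner e he] ePart e P),
        π.comp ι = LinearMap.id := by
  obtain ⟨m, f, g, hf, hg, h⟩ := Module.Finite.exists_comp_eq_id_of_projective A P
  refine ⟨m, (ePart.toPi he m).comp (ePart.map he g), (ePart.map he f).comp (ePart.ofPi he m), ?_⟩
  ext x
  exact LinearMap.congr_fun h x.1

def HasRes {A : Type} [Ring A] {e : A} (he : IsIdempotentElem e) (n : ℕ)
    (X : Type) [AddCommGroup X] [Module (Corner e he) X] : Prop :=
    ∃ (Q : ℕ → ModuleCat.{0} (Corner e he))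
      (d : ∀ k : ℕ, (Q (k + 1) : Type) →ₗ[Corner e he] (Q k : Type))
      (ε : (Q 0 : Type) →ₗ[Corner e he] X),
      (∀ k, n < k → Subsingleton (Q k)) ∧
      Function.Surjective ε ∧
      Function.Exact (d 0) ε ∧
      (∀ k, Function.Exact (d (k + 1)) (d k)) ∧
      (∀ k, k ≤ n → ∃ (m : ℕ)
        (ι : (Q k : Type) →ₗ[Corner e he] (Fin m → eASubgroup A e))
        (π : (Fin m → eASubgroup A e) →ₗ[Corner e he] (Q k : Type)),
        π.comp ι = LinearMap.id)

theorem HasRes.of_equiv {A : Type} [Ring A] {e : A} {he : IsIdempotentElem e} {n : ℕ}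
    {X Y : Type} [AddCommGroup X] [Module (Corner e he) X]
    [AddCommGroup Y] [Module (Corner e he) Y] (f : X ≃ₗ[Corner e he] Y)
    (h : HasRes he n X) : HasRes he n Y := by
  obtain ⟨Q, d, ε, h1, h2, h3, h4, h5⟩ := h
  refine ⟨Q, d, f.toLinearMap.comp ε, h1, f.surjective.comp h2, ?_, h4, h5⟩
  intro x
  rw [← h3 x]
  simp

/-- Splicing a resolution with a short exact sequence. -/
theorem HasRes.splice {A : Type} [Ring A] {e : A} {he : IsIdempotentElem e} {n : ℕ}
    {K P X : Type} [AddCommGroup X] [Module (Corner e he) X]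
    [AddCommGroup K] [Module (Corner e he) K] [AddCommGroup P] [Module (Corner e he) P]
    (i : K →ₗ[Corner e he] P) (p : P →ₗ[Corner e he] X)
    (hi : Function.Injective i) (hp : Function.Surjective p) (hip : Function.Exact i p)
    (hP : ∃ (m : ℕ) (ι : P →ₗ[Corner e he] (Fin m → eASubgroup A e))
        (π : (Fin m → eASubgroup A e) →ₗ[Corner e he] P),
        π.comp ι = LinearMap.id)
    (h : HasRes he n K) : HasRes he (n + 1) X := by
  obtain ⟨Q, d, ε, h1, h2, h3, h4, h5⟩ := h
  refine ⟨fun k => Nat.casesOn k (ModuleCat.of _ P) Q,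
    fun k => Nat.casesOn k (i.comp ε) d, p, ?_, hp, ?_, ?_, ?_⟩
  · rintro (_ | k) hk
    · omega
    · exact h1 k (by omega)
  · intro x
    rw [hip x]
    constructor
    · rintro ⟨y, rfl⟩
      obtain ⟨z, rfl⟩ := h2 y
      exact ⟨z, rfl⟩
    · rintro ⟨y, rfl⟩
      exact ⟨ε y, rfl⟩
  · rintro (_ | k)
    · intro x
      rw [← h3 x]
      exact map_eq_zero_iff i hi
    · exact h4 k
  · rintro (_ | k) hk
    · exact hP
    · exact h5 k (by omega)

theorem HasRes.base {A : Type} [Ring A] {e : A} {he : IsIdempotentElem e}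
    {P : Type} [AddCommGroup P] [Module (Corner e he) P]
    (hP : ∃ (m : ℕ) (ι : P →ₗ[Corner e he] (Fin m → eASubgroup A e))
        (π : (Fin m → eASubgroup A e) →ₗ[Corner e he] P),
        π.comp ι = LinearMap.id) : HasRes he 0 P := by
  refine ⟨fun k => Nat.casesOn k (ModuleCat.of _ P) (fun _ => ModuleCat.of _ PUnit),
    fun k => 0, LinearMap.id, ?_, fun x => ⟨x, rfl⟩, ?_, ?_, ?_⟩
  · rintro (_ | k) hk
    · omega
    · exact inferInstanceAs (Subsingleton PUnit)
  · intro x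
    constructor
    · intro h
      exact ⟨0, h.symm⟩
    · rintro ⟨y, rfl⟩
      rfl
  · intro k x
    constructor
    · intro _
      exact ⟨0, Subsingleton.elim (α := PUnit) _ _⟩
    · intro _
      rfl
  · rintro (_ | k) hk
    · exact hP
    · omega

theorem hasRes_ePart {A : Type} [Ring A] [IsNoetherianRing A] {e : A} (he : IsIdempotentElem e)
    (n : ℕ) (M : Type) [AddCommGroup M] [Module A M] [Module.Finite A M]
    (hM : HasProjectiveDimensionLE (ModuleCat.of A M) n) : HasRes he n (ePart e M) := by
  induction n generalizing M with
  | zero =>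
    rw [← projective_iff_hasProjectiveDimensionLE_zero, ← IsProjective.iff_projective] at hM
    exact HasRes.base (ePart_summand he M)
  | succ n ih =>
    obtain ⟨m, f, hf⟩ := Module.Finite.exists_fin' A M
    have S_exact := LinearMap.shortExact_shortComplexKer hf
    have proj : Projective (f.shortComplexKer).X₂ :=
      (IsProjective.iff_projective (R := A) (Fin m → A)).1 inferInstance
    have hK := (S_exact.hasProjectiveDimensionLT_X₃_iff n proj).1 hM
    refine HasRes.splice (ePart.map he (LinearMap.ker f).subtype) (ePart.map he f) ?_ ?_ ?_
      (ePart_summand he (Fin m → A)) (ih (LinearMap.ker f) hK)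
    · intro x y h
      exact Subtype.ext (Subtype.ext (congrArg (fun z => z.1) h))
    · rintro ⟨x, hx⟩
      obtain ⟨y, rfl⟩ := hf x
      refine ⟨⟨e • y, show e • e • y = e • y by rw [← mul_smul, he.eq]⟩, Subtype.ext ?_⟩
      exact (map_smul f e y).trans hx
    · intro x
      constructor
      · intro h
        exact ⟨⟨⟨x.1, congrArg Subtype.val h⟩, Subtype.ext x.2⟩, rfl⟩
      · rintro ⟨y, rfl⟩
        exact Subtype.ext y.1.2

theorem hasPD_of.{u} {A : Type} [Ring A] {M : ModuleCat.{u} A} {n : ℕ}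
    (h : hasProjDimLE A M n) :
    HasProjectiveDimensionLE M n := by
  obtain ⟨P, hP⟩ := h
  refine HasProjectiveDimensionLT.mk fun i hi Y x => ?_
  obtain ⟨f, hf, rfl⟩ := P.extMk_surjective x (i + 1) rfl
  obtain rfl : f = 0 := (hP i (by omega)).eq_of_src _ _
  exact P.extMk_zero _ _

theorem hasPD_zero.{u} {A : Type} [Ring A] {n : ℕ}
    (hgl : ∀ M : ModuleCat.{u} A, hasProjDimLE A M n) (M : ModuleCat.{0} A) :
    HasProjectiveDimensionLE M n := by
  have := hasPD_of (hgl (ModuleCat.of A (ULift.{u} M)))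
  exact ModuleCat.hasProjectiveDimensionLE_of_linearEquiv
    (M := ModuleCat.of A (ULift.{u} M)) (N := M) ULift.moduleEquiv n

theorem exists_ePart {A : Type} [Ring A] [IsNoetherianRing A] {e : A} (he : IsIdempotentElem e)
    (X : Type) [AddCommGroup X] [Module (Corner e he) X] [Module.Finite (Corner e he) X] :
    ∃ (M : ModuleCat.{0} A), Module.Finite A M ∧ Nonempty (ePart e M ≃ₗ[Corner e he] X) := by
  obtain ⟨k, p, hp⟩ := Module.Finite.exists_fin' (Corner e he) X
  let j : (Fin k → Corner e he) → (Fin k → A) := fun v i => (v i).1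
  let KA : Submodule A (Fin k → A) := Submodule.span A (j '' {v | p v = 0})
  let N : Submodule A (Fin k → A) :=
    { carrier := {v | ∀ i, v i * e = v i}
      add_mem' := fun {a b} ha hb i => by
        rw [Pi.add_apply, add_mul, ha i, hb i]
      zero_mem' := fun i => by simp
      smul_mem' := fun c x hx i => by
        rw [Pi.smul_apply, smul_eq_mul, mul_assoc, hx i] }
  let c : (Fin k → A) → (Fin k → Corner e he) := fun w i =>
    ⟨e * w i * e, by rw [← mul_assoc, ← mul_assoc, he.eq], by rw [mul_assoc, he.eq]⟩
  have hcadd : ∀ v w, c (v + w) = c v + c w := fun v w => funext fun i => Subtype.ext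
    (show e * (v i + w i) * e = e * v i * e + e * w i * e by rw [mul_add, add_mul])
  have hcj : ∀ v, c (j v) = v := fun v => funext fun i => Subtype.ext
    (show e * (v i).1 * e = (v i).1 by rw [(v i).2.1, (v i).2.2])
  have hcsm : ∀ (a : A) v, c (a • j v) =
      (show Corner e he from
        ⟨e * a * e, by rw [← mul_assoc, ← mul_assoc, he.eq], by rw [mul_assoc, he.eq]⟩) • v := fun a v => funext fun i => Subtype.ext
    (show e * (a * (v i).1) * e = e * a * e * (v i).1 by
      rw [mul_assoc, mul_assoc a, (v i).2.2, mul_assoc (e * a), (v i).2.1, mul_assoc])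
  have hc0 : c 0 = 0 := funext fun i => Subtype.ext
    (show e * 0 * e = 0 by simp)
  have key : ∀ w ∈ KA, ∀ a : A, p (c (a • w)) = 0 := by
    intro w hw
    induction hw using Submodule.span_induction with
    | mem x hx =>
      obtain ⟨v, hv, rfl⟩ := hx
      intro a
      rw [hcsm, map_smul, show p v = 0 from hv, smul_zero]
    | zero => intro a; rw [smul_zero, hc0, map_zero]
    | add x y _ _ hx hy => intro a; rw [smul_add, hcadd, map_add, hx, hy, add_zero]
    | smul b x _ hx => intro a; rw [← mul_smul]; exact hx _
  have hker : ∀ v, j v ∈ KA ↔ p v = 0 := by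
    intro v
    constructor
    · intro h
      have := key _ h 1
      rwa [one_smul, hcj] at this
    · intro h
      exact Submodule.subset_span ⟨v, h, rfl⟩
  let M : Submodule A ((Fin k → A) ⧸ KA) := N.map KA.mkQ
  let φ : (Fin k → Corner e he) →ₗ[Corner e he] ePart e M :=
    { toFun := fun v => ⟨⟨KA.mkQ (j v), ⟨j v, fun i => (v i).2.2, rfl⟩⟩,
        Subtype.ext (show e • KA.mkQ (j v) = KA.mkQ (j v) by
          rw [← map_smul]
          exact congrArg _ (funext fun i => (v i).2.1))⟩
      map_add' := fun v w => rfl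
      map_smul' := fun x v => rfl }
  have hφ : Function.Surjective φ := by
    rintro ⟨⟨_, ⟨v, hv, rfl⟩⟩, hx⟩
    have hx' : e • KA.mkQ v = KA.mkQ v := congrArg Subtype.val hx
    refine ⟨c v, Subtype.ext (Subtype.ext ?_)⟩
    refine Eq.trans ?_ hx'
    rw [← map_smul]
    refine congrArg KA.mkQ (funext fun i => ?_)
    show e * v i * e = e * v i
    rw [mul_assoc, hv i]
  have hk : LinearMap.ker φ = LinearMap.ker p := by
    ext v
    rw [LinearMap.mem_ker, LinearMap.mem_ker, ← hker v, ← Submodule.Quotient.mk_eq_zero]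
    constructor
    · intro h
      exact congrArg (fun z => z.1.1) h
    · intro h
      exact Subtype.ext (Subtype.ext h)
  refine ⟨ModuleCat.of A M, inferInstanceAs (Module.Finite A M), ⟨?_⟩⟩
  exact ((φ.quotKerEquivOfSurjective hφ).symm.trans (Submodule.quotEquivOfEq _ _ hk)).trans
    (p.quotKerEquivOfSurjective hp)

/-- Let `A` be a noetherian ring of global dimension at most `n`, let
`e ∈ A` be an idempotent and `E = eAe`. Then every finitely generated left `E`-module `X`
admits an exact sequence `0 → Q_n → ⋯ → Q_0 → X → 0` in which each `Q_i` is a direct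
summand of a finite direct sum of copies of the left `E`-module `eA`.  (The exact sequence
is encoded as an everywhere-exact resolution `⋯ → Q_1 → Q_0 → X → 0` with `Q_k = 0` for
`k > n`.) -/
theorem corner_module_has_add_eA_resolution
    (n : ℕ) (A : Type) [Ring A] [IsNoetherianRing A] [IsNoetherianRing Aᵐᵒᵖ]
    (hgl : ∀ M : ModuleCat A, hasProjDimLE A M n)
    (e : A) (he : IsIdempotentElem e)
    (X : Type) [AddCommGroup X] [Module (Corner e he) X] [Module.Finite (Corner e he) X] :
    ∃ (Q : ℕ → ModuleCat (Corner e he))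
      (d : ∀ k : ℕ, (Q (k + 1) : Type) →ₗ[Corner e he] (Q k : Type))
      (ε : (Q 0 : Type) →ₗ[Corner e he] X),
      (∀ k, n < k → Subsingleton (Q k)) ∧
      Function.Surjective ε ∧
      Function.Exact (d 0) ε ∧
      (∀ k, Function.Exact (d (k + 1)) (d k)) ∧
      (∀ k, k ≤ n → ∃ (m : ℕ)
        (ι : (Q k : Type) →ₗ[Corner e he] (Fin m → eASubgroup A e))
        (π : (Fin m → eASubgroup A e) →ₗ[Corner e he] (Q k : Type)),
        π.comp ι = LinearMap.id) := by
  obtain ⟨M, hfin, ⟨f⟩⟩ := exists_ePart he X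
  exact HasRes.of_equiv f (hasRes_ePart he n M (hasPD_zero hgl M))
end

section
/- Let K be a field, let Δ and Γ be finite-dimensional K-algebras, and set Λ = Δ ⊗_K Γ. Let P be a finitely generated projective left Δ-module and let M be a finitely generated left Γ-module with a minimal projective presentation Q^{-1} →f Q^0 → M → 0. Then P ⊗_K Q^{-1} → P ⊗_K Q^0 → P ⊗_K M → 0 (with maps id_P ⊗ f and id_P ⊗ (Q^0 → M)) is a minimal projective presentation of the left Λ-module P ⊗_K M. -/
open TensorProduct

section TensorModule

variable (K : Type) [Field K]
variable (Γ : Type) [Ring Γ] [Algebra K Γ]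
variable (N : Type) [AddCommGroup N] [Module K N] [Module Γ N] [IsScalarTower K Γ N]

/-- Scalar multiplication by `γ` on a left `Γ`-module, as a `K`-linear map. -/
def lsmulK (γ : Γ) : N →ₗ[K] N where
  toFun n := γ • n
  map_add' := smul_add γ
  map_smul' k n := show γ • (k • n) = k • (γ • n) by
    rw [← algebraMap_smul Γ k n, ← mul_smul, ← Algebra.commutes k γ, mul_smul,
      algebraMap_smul]

variable (M : Type) [AddCommGroup M] [Module K M]

/-- The action of `Γ` on `M ⊗[K] N` through the right-hand factor. -/
noncomputable instance (priority := 50) TensorProduct.rightFactorModule :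
    Module Γ (M ⊗[K] N) where
  smul γ x := LinearMap.lTensor M (lsmulK K Γ N γ) x
  one_smul x := by
    show LinearMap.lTensor M (lsmulK K Γ N 1) x = x
    have h : lsmulK K Γ N (1 : Γ) = LinearMap.id := LinearMap.ext fun n => one_smul Γ n
    rw [h, LinearMap.lTensor_id, LinearMap.id_apply]
  mul_smul γ δ x := by
    show LinearMap.lTensor M (lsmulK K Γ N (γ * δ)) x =
      LinearMap.lTensor M (lsmulK K Γ N γ) (LinearMap.lTensor M (lsmulK K Γ N δ) x)
    have h : lsmulK K Γ N (γ * δ) = (lsmulK K Γ N γ).comp (lsmulK K Γ N δ) :=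
      LinearMap.ext fun n => mul_smul γ δ n
    rw [h, LinearMap.lTensor_comp, LinearMap.comp_apply]
  smul_zero γ := map_zero _
  smul_add γ x y := map_add _ x y
  add_smul γ δ x := by
    show LinearMap.lTensor M (lsmulK K Γ N (γ + δ)) x =
      LinearMap.lTensor M (lsmulK K Γ N γ) x + LinearMap.lTensor M (lsmulK K Γ N δ) x
    have h : lsmulK K Γ N (γ + δ) = lsmulK K Γ N γ + lsmulK K Γ N δ :=
      LinearMap.ext fun n => add_smul γ δ n
    rw [h, LinearMap.lTensor_add, LinearMap.add_apply]
  zero_smul x := by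
    show LinearMap.lTensor M (lsmulK K Γ N (0 : Γ)) x = 0
    have h : lsmulK K Γ N (0 : Γ) = 0 := LinearMap.ext fun n => zero_smul Γ n
    rw [h, LinearMap.lTensor_zero, LinearMap.zero_apply]

theorem rightFactor_smul_tmul (γ : Γ) (m : M) (n : N) :
    γ • (m ⊗ₜ[K] n) = m ⊗ₜ[K] (γ • n) := by
  show LinearMap.lTensor M (lsmulK K Γ N γ) (m ⊗ₜ[K] n) = m ⊗ₜ[K] (γ • n)
  rw [LinearMap.lTensor_tmul]; rfl

variable (Δ : Type) [Ring Δ] [Algebra K Δ] [Module Δ M] [IsScalarTower K Δ M]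

instance : SMulCommClass Δ Γ (M ⊗[K] N) where
  smul_comm δ γ x := by
    induction x using TensorProduct.induction_on with
    | zero => simp only [smul_zero]
    | tmul m n =>
        rw [rightFactor_smul_tmul, smul_tmul', smul_tmul', rightFactor_smul_tmul]
    | add x y hx hy => simp only [smul_add, hx, hy]

instance rightFactorTower : IsScalarTower K Γ (M ⊗[K] N) where
  smul_assoc k γ x := by
    induction x using TensorProduct.induction_on with
    | zero => simp only [smul_zero]
    | tmul m n =>
        rw [rightFactor_smul_tmul, rightFactor_smul_tmul, smul_assoc, smul_tmul']
        exact (smul_tmul k m (γ • n)).symm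
    | add x y hx hy => simp only [smul_add, hx, hy]

/-- The left `Δ ⊗[K] Γ`-module structure on `M ⊗[K] N`, characterized by
`(δ ⊗ γ) • (m ⊗ n) = (δ • m) ⊗ (γ • n)`. -/
noncomputable instance (priority := 2000) tensorTensorModule : Module (Δ ⊗[K] Γ) (M ⊗[K] N) :=
  @TensorProduct.Algebra.module K Δ Γ (M ⊗[K] N) _ _ _ _ _ _ _ _ _
    TensorProduct.isScalarTower_left (rightFactorTower K Γ N M) _

theorem tensorModule_smul_tmul (δ : Δ) (γ : Γ) (m : M) (n : N) :
    (δ ⊗ₜ[K] γ) • (m ⊗ₜ[K] n) = (δ • m) ⊗ₜ[K] (γ • n) := by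
  have h : (δ ⊗ₜ[K] γ) • (m ⊗ₜ[K] n) = δ • (γ • (m ⊗ₜ[K] n)) := rfl
  rw [h, rightFactor_smul_tmul, smul_tmul']

end TensorModule

open TensorProduct

/-- The radical `rad N = J(A)·N` of a left `A`-module `N`, where `J(A)` is the Jacobson
radical of `A` (the Jacobson radical of the zero ideal). -/
def radSubmodule (A : Type) [Ring A] (N : Type) [AddCommGroup N] [Module A N] :
    Submodule A N :=
  Submodule.span A {x : N | ∃ r ∈ (⊥ : Ideal A).jacobson, ∃ m : N, x = r • m}

section Helpers

variable {K : Type} [Field K] {Δ : Type} [Ring Δ] [Algebra K Δ] {Γ : Type} [Ring Γ] [Algebra K Γ]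
variable {P P' Q Q' : Type}
  [AddCommGroup P] [Module K P] [Module Δ P] [IsScalarTower K Δ P]
  [AddCommGroup P'] [Module K P'] [Module Δ P'] [IsScalarTower K Δ P']
  [AddCommGroup Q] [Module K Q] [Module Γ Q] [IsScalarTower K Γ Q]
  [AddCommGroup Q'] [Module K Q'] [Module Γ Q'] [IsScalarTower K Γ Q']

/-- A K-linear map commuting with pure tensors is linear over the tensor algebra. -/
noncomputable def tlift {X : Type} [AddCommGroup X] [Module K X] [Module (Δ ⊗[K] Γ) X]
    (a : (P ⊗[K] Q) →ₗ[K] X)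
    (h : ∀ (δ : Δ) (γ : Γ) (p : P) (q : Q),
      a ((δ • p) ⊗ₜ[K] (γ • q)) = (δ ⊗ₜ[K] γ) • a (p ⊗ₜ[K] q)) :
    (P ⊗[K] Q) →ₗ[Δ ⊗[K] Γ] X where
  toFun := a
  map_add' := map_add a
  map_smul' r x := by
    simp only [RingHom.id_apply]
    induction r using TensorProduct.induction_on with
    | zero => simp only [zero_smul, map_zero]
    | add r s hr hs => simp only [add_smul, map_add, hr, hs]
    | tmul δ γ =>
      induction x using TensorProduct.induction_on with
      | zero => simp only [smul_zero, map_zero]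
      | add x y hx hy => simp only [smul_add, map_add, hx, hy]
      | tmul p q => rw [tensorModule_smul_tmul, h]

noncomputable def tmap (a : P →ₗ[Δ] P') (b : Q →ₗ[Γ] Q') :
    (P ⊗[K] Q) →ₗ[Δ ⊗[K] Γ] (P' ⊗[K] Q') :=
  tlift (TensorProduct.map (a.restrictScalars K) (b.restrictScalars K)) (by
    intro δ γ p q
    simp only [TensorProduct.map_tmul, LinearMap.restrictScalars_apply, map_smul,
      tensorModule_smul_tmul])

theorem tmap_apply (a : P →ₗ[Δ] P') (b : Q →ₗ[Γ] Q') (x : P ⊗[K] Q) :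
    tmap a b x = TensorProduct.map (a.restrictScalars K) (b.restrictScalars K) x := rfl

theorem tmap_tmul (a : P →ₗ[Δ] P') (b : Q →ₗ[Γ] Q') (p : P) (q : Q) :
    tmap a b (p ⊗ₜ[K] q) = a p ⊗ₜ[K] b q := rfl

theorem finproj_of_equiv {L X ι : Type} [Ring L] [AddCommGroup X] [Module L X] [Finite ι]
    (e : X ≃+ (ι →₀ L)) (h : ∀ l x i, e (l • x) i = l * e x i) :
    Module.Finite L X ∧ Module.Projective L X := by
  have e' : X ≃ₗ[L] (ι →₀ L) :=
    { e with map_smul' := fun l x => by ext i; exact h l x i }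
  exact ⟨Module.Finite.equiv e'.symm, Module.Projective.of_equiv e'.symm⟩

theorem finproj_free (m n : ℕ) :
    Module.Finite (Δ ⊗[K] Γ) ((Fin m →₀ Δ) ⊗[K] (Fin n →₀ Γ)) ∧
    Module.Projective (Δ ⊗[K] Γ) ((Fin m →₀ Δ) ⊗[K] (Fin n →₀ Γ)) := by
  refine finproj_of_equiv (L := Δ ⊗[K] Γ)
    (X := (Fin m →₀ Δ) ⊗[K] (Fin n →₀ Γ)) (ι := Fin m × Fin n) (finsuppTensorFinsupp K K Δ Γ (Fin m) (Fin n)).toAddEquiv ?_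
  intro r x i
  change finsuppTensorFinsupp K K Δ Γ (Fin m) (Fin n) (r • x) i =
    r * finsuppTensorFinsupp K K Δ Γ (Fin m) (Fin n) x i
  induction r using TensorProduct.induction_on with
  | zero =>
    rw [zero_mul]
    refine (congrArg (fun y => finsuppTensorFinsupp K K Δ Γ (Fin m) (Fin n) y i)
      (zero_smul (Δ ⊗[K] Γ) x)).trans ?_
    simp only [map_zero, Finsupp.zero_apply]
  | add r s hr hs => simp only [add_smul, map_add, add_mul, Finsupp.add_apply, hr, hs]
  | tmul δ γ =>
    induction x using TensorProduct.induction_on with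
    | zero => simp only [smul_zero, map_zero, mul_zero, Finsupp.zero_apply]
    | add x y hx hy => simp only [smul_add, map_add, mul_add, Finsupp.add_apply, hx, hy]
    | tmul p q =>
      rw [tensorModule_smul_tmul]
      obtain ⟨i, j⟩ := i
      simp only [finsuppTensorFinsupp_apply, Finsupp.smul_apply, smul_eq_mul,
        Algebra.TensorProduct.tmul_mul_tmul]

theorem tensor_finite_projective [Module.Finite Δ P] [Module.Projective Δ P]
    [Module.Finite Γ Q] [Module.Projective Γ Q] :
    Module.Finite (Δ ⊗[K] Γ) (P ⊗[K] Q) ∧ Module.Projective (Δ ⊗[K] Γ) (P ⊗[K] Q) := by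
  obtain ⟨m, a0, ha0⟩ := Module.Finite.exists_fin' Δ P
  obtain ⟨n, b0, hb0⟩ := Module.Finite.exists_fin' Γ Q
  let a : (Fin m →₀ Δ) →ₗ[Δ] P := a0 ∘ₗ (Finsupp.linearEquivFunOnFinite Δ Δ (Fin m)).toLinearMap
  let b : (Fin n →₀ Γ) →ₗ[Γ] Q := b0 ∘ₗ (Finsupp.linearEquivFunOnFinite Γ Γ (Fin n)).toLinearMap
  have ha : Function.Surjective a := ha0.comp (LinearEquiv.surjective _)
  have hb : Function.Surjective b := hb0.comp (LinearEquiv.surjective _)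
  obtain ⟨s, hs⟩ := Module.projective_lifting_property a LinearMap.id ha
  obtain ⟨t, ht⟩ := Module.projective_lifting_property b LinearMap.id hb
  have hst : (tmap a b : _ →ₗ[Δ ⊗[K] Γ] (P ⊗[K] Q)) ∘ₗ tmap s t = LinearMap.id := by
    ext x
    rw [LinearMap.comp_apply, LinearMap.id_apply]
    induction x using TensorProduct.induction_on with
    | zero => simp only [map_zero]
    | add x y hx hy => simp only [map_add, hx, hy]
    | tmul p q =>
      rw [tmap_tmul, tmap_tmul]
      have h1 := LinearMap.congr_fun hs p
      have h2 := LinearMap.congr_fun ht q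
      simp only [LinearMap.comp_apply, LinearMap.id_apply] at h1 h2
      rw [h1, h2]
  obtain ⟨_, _⟩ := finproj_free (K := K) (Δ := Δ) (Γ := Γ) m n
  refine ⟨Module.Finite.of_surjective (tmap a b) ?_, Module.Projective.of_split _ _ hst⟩
  intro x
  exact ⟨tmap s t x, LinearMap.congr_fun hst x⟩

theorem mem_jac [FiniteDimensional K Γ] (r : Γ) (hr : r ∈ (⊥ : Ideal Γ).jacobson) :
    (1 : Δ) ⊗ₜ[K] r ∈ (⊥ : Ideal (Δ ⊗[K] Γ)).jacobson := by
  set J := (⊥ : Ideal Γ).jacobson with hJ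
  have : IsArtinianRing Γ := IsArtinianRing.of_finite K Γ
  obtain ⟨n, hn⟩ : IsNilpotent J := IsArtinianRing.isNilpotent_jacobson_bot
  have : J.IsTwoSided := by
    rw [hJ]; infer_instance
  let S : ℕ → Submodule K (Δ ⊗[K] Γ) := fun k =>
    Submodule.span K {x | ∃ (δ : Δ) (γ : Γ), γ ∈ J ^ k ∧ x = δ ⊗ₜ[K] γ}
  have hmul : ∀ k l, ∀ x ∈ S k, ∀ y ∈ S l, x * y ∈ S (k + l) := by
    intro k l x hx y hy
    have h := Submodule.mul_mem_mul hx hy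
    rw [Submodule.span_mul_span] at h
    refine Submodule.span_mono ?_ h
    rintro _ ⟨_, ⟨d, g, hg, rfl⟩, _, ⟨d', g', hg', rfl⟩, rfl⟩
    refine ⟨d * d', g * g', ?_, ?_⟩
    · rw [Ideal.IsTwoSided.pow_add]; exact Ideal.mul_mem_mul hg hg'
    · exact Algebra.TensorProduct.tmul_mul_tmul _ _ _ _
  have htop : ∀ x, x ∈ S 0 := by
    intro x
    induction x using TensorProduct.induction_on with
    | zero => exact zero_mem _
    | add x y hx hy => exact add_mem hx hy
    | tmul d g => exact Submodule.subset_span ⟨d, g, by rw [Submodule.pow_zero, Ideal.one_eq_top]; trivial, rfl⟩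
  have hpow : ∀ x ∈ S 1, ∀ k, x ^ k ∈ S k := by
    intro x hx k
    induction k with
    | zero => exact htop _
    | succ k ih => rw [pow_succ]; exact hmul _ _ _ ih _ hx
  have hSn : S n = ⊥ := by
    rw [Submodule.span_eq_bot]
    rintro _ ⟨d, g, hg, rfl⟩
    rw [hn] at hg
    have : g = 0 := by simpa using hg
    rw [this, TensorProduct.tmul_zero]
  rw [Ideal.mem_jacobson_iff]
  intro y
  have hx1 : (1 : Δ) ⊗ₜ[K] r ∈ S 1 :=
    Submodule.subset_span ⟨1, r, by rwa [Submodule.pow_one], rfl⟩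
  have hyx : y * ((1 : Δ) ⊗ₜ[K] r) ∈ S 1 := by
    have := hmul 0 1 y (htop y) _ hx1
    rwa [zero_add] at this
  have hnil : IsNilpotent (y * ((1 : Δ) ⊗ₜ[K] r)) :=
    ⟨n, by have := hpow _ hyx n; rwa [hSn, Submodule.mem_bot] at this⟩
  obtain ⟨u, hu⟩ := hnil.isUnit_add_one
  refine ⟨(↑u⁻¹ : Δ ⊗[K] Γ), ?_⟩
  rw [Ideal.mem_bot, sub_eq_zero, mul_assoc]
  calc _ = (↑u⁻¹ : Δ ⊗[K] Γ) * (y * ((1 : Δ) ⊗ₜ[K] r) + 1) := by rw [mul_add, mul_one]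
    _ = 1 := by rw [← hu, Units.inv_mul]

theorem tmul_mem_rad [FiniteDimensional K Γ] (p : P) (q : Q) (hq : q ∈ radSubmodule Γ Q) :
    p ⊗ₜ[K] q ∈ radSubmodule (Δ ⊗[K] Γ) (P ⊗[K] Q) := by
  have key : ∀ (γ : Γ) (q : Q), p ⊗ₜ[K] (γ • q) = ((1 : Δ) ⊗ₜ[K] γ) • (p ⊗ₜ[K] q) := by
    intro γ q
    rw [tensorModule_smul_tmul, one_smul]
  unfold radSubmodule at hq
  induction hq using Submodule.span_induction with
  | mem x hx =>
    obtain ⟨r, hr, m, rfl⟩ := hx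
    exact Submodule.subset_span ⟨_, mem_jac (Δ := Δ) r hr, p ⊗ₜ[K] m, key r m⟩
  | zero => rw [TensorProduct.tmul_zero]; exact zero_mem _
  | add x y _ _ hx hy => rw [TensorProduct.tmul_add]; exact add_mem hx hy
  | smul a x _ hx => rw [key]; exact Submodule.smul_mem _ _ hx

end Helpers

/-- Let `Δ`, `Γ` be finite-dimensional algebras over a field `K` and
`Λ = Δ ⊗_K Γ`.  If `P` is a finitely generated projective left `Δ`-module and
`Q¹ →f Q⁰ →g M → 0` is a minimal projective presentation of a finitely generated left
`Γ`-module `M`, then `P ⊗ Q¹ → P ⊗ Q⁰ → P ⊗ M → 0` (with maps `id_P ⊗ f` and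
`id_P ⊗ g`) is a minimal projective presentation of the left `Λ`-module `P ⊗_K M`. -/
theorem tensor_minimal_projective_presentation
    (K : Type) [Field K]
    (Δ : Type) [Ring Δ] [Algebra K Δ] [FiniteDimensional K Δ]
    (Γ : Type) [Ring Γ] [Algebra K Γ] [FiniteDimensional K Γ]
    (P : Type) [AddCommGroup P] [Module K P] [Module Δ P] [IsScalarTower K Δ P]
    [Module.Finite Δ P] [Module.Projective Δ P]
    (M Q1 Q0 : Type)
    [AddCommGroup M] [Module K M] [Module Γ M] [IsScalarTower K Γ M] [Module.Finite Γ M]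
    [AddCommGroup Q1] [Module K Q1] [Module Γ Q1] [IsScalarTower K Γ Q1]
    [Module.Finite Γ Q1] [Module.Projective Γ Q1]
    [AddCommGroup Q0] [Module K Q0] [Module Γ Q0] [IsScalarTower K Γ Q0]
    [Module.Finite Γ Q0] [Module.Projective Γ Q0]
    (f : Q1 →ₗ[Γ] Q0) (g : Q0 →ₗ[Γ] M)
    (hsurj : Function.Surjective g)
    (hexact : Function.Exact f g)
    (hmin1 : LinearMap.range f ≤ radSubmodule Γ Q0)
    (hmin2 : LinearMap.ker f ≤ radSubmodule Γ Q1) :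
    ∃ (F : (P ⊗[K] Q1) →ₗ[Δ ⊗[K] Γ] (P ⊗[K] Q0))
      (G : (P ⊗[K] Q0) →ₗ[Δ ⊗[K] Γ] (P ⊗[K] M)),
      (∀ (p : P) (q : Q1), F (p ⊗ₜ[K] q) = p ⊗ₜ[K] (f q)) ∧
      (∀ (p : P) (q : Q0), G (p ⊗ₜ[K] q) = p ⊗ₜ[K] (g q)) ∧
      Module.Finite (Δ ⊗[K] Γ) (P ⊗[K] Q1) ∧ Module.Projective (Δ ⊗[K] Γ) (P ⊗[K] Q1) ∧
      Module.Finite (Δ ⊗[K] Γ) (P ⊗[K] Q0) ∧ Module.Projective (Δ ⊗[K] Γ) (P ⊗[K] Q0) ∧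
      Function.Surjective G ∧
      Function.Exact F G ∧
      LinearMap.range F ≤ radSubmodule (Δ ⊗[K] Γ) (P ⊗[K] Q0) ∧
      LinearMap.ker F ≤ radSubmodule (Δ ⊗[K] Γ) (P ⊗[K] Q1) := by
  have hF : ∀ x : P ⊗[K] Q1, tmap (K := K) (LinearMap.id : P →ₗ[Δ] P) f x
      = LinearMap.lTensor P (f.restrictScalars K) x := fun x => rfl
  have hG : ∀ x : P ⊗[K] Q0, tmap (K := K) (LinearMap.id : P →ₗ[Δ] P) g x
      = LinearMap.lTensor P (g.restrictScalars K) x := fun x => rfl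
  refine ⟨tmap LinearMap.id f, tmap LinearMap.id g, fun p q => rfl, fun p q => rfl,
    tensor_finite_projective.1, tensor_finite_projective.2,
    tensor_finite_projective.1, tensor_finite_projective.2, ?_, ?_, ?_, ?_⟩
  · exact LinearMap.lTensor_surjective P (g := g.restrictScalars K) hsurj
  · exact lTensor_exact P (f := f.restrictScalars K) (g := g.restrictScalars K) hexact hsurj
  · rintro _ ⟨x, rfl⟩
    induction x using TensorProduct.induction_on with
    | zero => rw [map_zero]; exact zero_mem _
    | add x y hx hy => rw [map_add]; exact add_mem hx hy
    | tmul p q => exact tmul_mem_rad p (f q) (hmin1 ⟨q, rfl⟩)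
  · intro x hx
    have hx' : LinearMap.lTensor P (f.restrictScalars K) x = 0 := hx
    have hex : Function.Exact (LinearMap.ker (f.restrictScalars K)).subtype
        (f.restrictScalars K) := LinearMap.exact_subtype_ker_map _
    obtain ⟨y, rfl⟩ := (Module.Flat.lTensor_exact P hex x).1 hx'
    clear hx hx'
    induction y using TensorProduct.induction_on with
    | zero => rw [map_zero]; exact zero_mem _
    | add x y hx hy => rw [map_add]; exact add_mem hx hy
    | tmul p q => exact tmul_mem_rad p (q : Q1) (hmin2 q.2)
end

section
/- Let n ≥ 3, let m = 2n − 1, let ε ∈ ℂ be a primitive m-th root of unity, and let the cyclic group G of order m act ℂ-linearly on the polynomial ring ℂ[x, y] with a chosen generator acting by x ↦ εx and y ↦ ε²y. Then the invariant subalgebra ℂ[x, y]^G equals the ℂ-subalgebra of ℂ[x, y] generated by the n + 1 elements x^m, x^{m−2}y, x^{m−4}y², …, x y^{n−1}, y^m (that is, by x^{m−2j} y^j for 0 ≤ j ≤ n − 1 together with y^m). -/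
open MvPolynomial

lemma aux_mono (n : ℕ) (hn : 3 ≤ n) (m : ℕ) (hm : m = 2 * n - 1)
    (S : Subalgebra ℂ (MvPolynomial (Fin 2) ℂ))
    (h1 : ∀ j < n, (X 0 ^ (m - 2 * j) * X 1 ^ j : MvPolynomial (Fin 2) ℂ) ∈ S)
    (h2 : (X 1 ^ m : MvPolynomial (Fin 2) ℂ) ∈ S) :
    ∀ N a b : ℕ, a + b = N → m ∣ a + 2 * b →
      (X 0 ^ a * X 1 ^ b : MvPolynomial (Fin 2) ℂ) ∈ S := by
  intro N
  induction N using Nat.strong_induction_on with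
  | _ N ih =>
  intro a b hN hd
  by_cases hb : m ≤ b
  · obtain ⟨c, rfl⟩ := Nat.exists_eq_add_of_le hb
    have hd' : m ∣ a + 2 * c := by
      have e : a + 2 * (m + c) = (a + 2 * c) + m * 2 := by ring
      rw [e] at hd
      exact (Nat.dvd_add_left (Dvd.intro _ rfl)).1 hd
    have := S.mul_mem h2 (ih (a + c) (by omega) a c rfl hd')
    convert this using 1
    ring
  by_cases ha : m ≤ a
  · obtain ⟨c, rfl⟩ := Nat.exists_eq_add_of_le ha
    have hd' : m ∣ c + 2 * b := by
      have e : m + c + 2 * b = (c + 2 * b) + m * 1 := by ring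
      rw [e] at hd
      exact (Nat.dvd_add_left (Dvd.intro _ rfl)).1 hd
    have := S.mul_mem (h1 0 (by omega)) (ih (c + b) (by omega) c b rfl hd')
    convert this using 1
    simp only [mul_zero, Nat.sub_zero, pow_zero]
    ring
  obtain ⟨k, hk⟩ := hd
  have hk3 : k < 3 := by
    by_contra hh
    have : m * 3 ≤ m * k := Nat.mul_le_mul_left _ (by omega)
    omega
  interval_cases k
  · have ha0 : a = 0 := by omega
    have hb0 : b = 0 := by omega
    subst ha0 hb0
    simpa using S.one_mem
  · have := h1 b (by omega)
    have e : m - 2 * b = a := by omega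
    rwa [e] at this
  · obtain ⟨c, rfl⟩ : ∃ c, b = (n - 1) + c := Nat.exists_eq_add_of_le (by omega)
    obtain ⟨d, rfl⟩ : ∃ d, a = 1 + d := Nat.exists_eq_add_of_le (by omega)
    have h3 := h1 (n - 1) (by omega)
    have e : m - 2 * (n - 1) = 1 := by omega
    rw [e] at h3
    have := S.mul_mem h3 (ih (d + c) (by omega) d c rfl ⟨1, by omega⟩)
    convert this using 1
    ring

lemma aux_monomial (d : Fin 2 →₀ ℕ) (c : ℂ) :
    monomial d c = C c * (X 0 ^ d 0 * X 1 ^ d 1) := by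
  rw [monomial_eq, Finsupp.prod_fintype _ _ (by simp)]
  simp

lemma aux_coeff (ε : ℂ)
    (σ : MvPolynomial (Fin 2) ℂ →ₐ[ℂ] MvPolynomial (Fin 2) ℂ)
    (hσx : σ (X 0) = C ε * X 0)
    (hσy : σ (X 1) = C (ε ^ 2) * X 1) (p : MvPolynomial (Fin 2) ℂ) (d : Fin 2 →₀ ℕ) :
    coeff d (σ p) = ε ^ (d 0 + 2 * d 1) * coeff d p := by
  induction p using MvPolynomial.induction_on' with
  | monomial u a =>
    have : σ (monomial u a) = monomial u (ε ^ (u 0 + 2 * u 1) * a) := by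
      rw [aux_monomial, aux_monomial, map_mul, map_mul, map_pow, map_pow, hσx, hσy]
      have : σ (C a) = C a := σ.commutes a
      rw [this]
      simp only [map_mul, map_pow]
      ring
    rw [this, coeff_monomial, coeff_monomial]
    split_ifs with h
    · rw [h]
    · simp
  | add p q hp hq => rw [map_add, coeff_add, coeff_add, hp, hq]; ring

theorem invariant_ring_generated_by_monomials
    (n : ℕ) (hn : 3 ≤ n) (m : ℕ) (hm : m = 2 * n - 1)
    (ε : ℂ) (hε : IsPrimitiveRoot ε m)
    (σ : MvPolynomial (Fin 2) ℂ →ₐ[ℂ] MvPolynomial (Fin 2) ℂ)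
    (hσx : σ (X 0) = C ε * X 0)
    (hσy : σ (X 1) = C (ε ^ 2) * X 1) :
    {p : MvPolynomial (Fin 2) ℂ | σ p = p} =
      (Algebra.adjoin ℂ
        ((Set.range fun j : Fin n => X 0 ^ (m - 2 * (j : ℕ)) * X 1 ^ (j : ℕ)) ∪
          {X 1 ^ m}) : Subalgebra ℂ (MvPolynomial (Fin 2) ℂ)) := by
  ext p
  constructor
  · intro hp
    change σ p = p at hp
    rw [SetLike.mem_coe, p.as_sum]
    refine Subalgebra.sum_mem _ fun d hd => ?_
    rw [aux_monomial]
    refine Subalgebra.mul_mem _ (Subalgebra.algebraMap_mem _ _) ?_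
    refine aux_mono n hn m hm _ (fun j hj => Algebra.subset_adjoin (Or.inl ⟨⟨j, hj⟩, rfl⟩))
      (Algebra.subset_adjoin (Or.inr rfl)) _ _ _ rfl ?_
    have h := aux_coeff ε σ hσx hσy p d
    rw [hp] at h
    rw [mem_support_iff] at hd
    apply hε.dvd_of_pow_eq_one
    exact mul_right_cancel₀ hd (by rw [← h, one_mul])
  · intro hp
    change σ p = (AlgHom.id ℂ _) p
    have key : ∀ a b : ℕ, m ∣ a + 2 * b →
        σ (X 0 ^ a * X 1 ^ b) = X 0 ^ a * X 1 ^ b := by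
      intro a b hab
      have h1 : ε ^ (a + 2 * b) = 1 := (hε.pow_eq_one_iff_dvd _).2 hab
      have h2 : (C ε : MvPolynomial (Fin 2) ℂ) ^ (a + 2 * b) = 1 := by
        rw [← map_pow, h1, map_one]
      rw [map_mul, map_pow, map_pow, hσx, hσy, map_pow]
      calc _ = (C ε : MvPolynomial (Fin 2) ℂ) ^ (a + 2 * b) * (X 0 ^ a * X 1 ^ b) := by ring
        _ = _ := by rw [h2, one_mul]
    have hle : Algebra.adjoin ℂ
        ((Set.range fun j : Fin n => X 0 ^ (m - 2 * (j : ℕ)) * X 1 ^ (j : ℕ)) ∪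
          {X 1 ^ m}) ≤ AlgHom.equalizer σ (AlgHom.id ℂ (MvPolynomial (Fin 2) ℂ)) := by
      apply Algebra.adjoin_le
      rintro q (⟨j, rfl⟩ | rfl)
      · exact key _ _ ⟨1, by have := j.2; omega⟩
      · simpa using key 0 m ⟨2, by ring⟩
    exact hle hp
end

section
/- Let n ≥ 3 and m = 2n − 1, and let G = 1/m(1,2) act on ℂ[x, y] as above. Let φ: ℂ[a, b₁, …, b_{n−1}, c] → ℂ[x, y] be the ℂ-algebra homomorphism determined by φ(a) = x^m, φ(b_j) = x^{m−2j} y^j for 1 ≤ j ≤ n − 1, and φ(c) = y^m. Then the kernel of φ is the ideal generated by the 2×2 minors of the 2×n matrix whose first row is (a, b₁, b₂, …, b_{n−2}, b_{n−1}²) and whose second row is (b₁, b₂, b₃, …, b_{n−1}, c). In particular, the invariant ring ℂ[x, y]^G is isomorphic to ℂ[a, b₁, …, b_{n−1}, c] modulo this determinantal ideal. -/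
/-!
Statement 9: The kernel of the presentation map
`φ : ℂ[a, b₁, …, b_{n−1}, c] → ℂ[x, y]`, `a ↦ x^m`, `b_j ↦ x^{m−2j} y^j`, `c ↦ y^m`
(where `m = 2n − 1`), is the ideal generated by the 2×2 minors of the matrix
`(a, b₁, …, b_{n−2}, b_{n−1}²; b₁, b₂, …, b_{n−1}, c)`.  In particular the invariant
ring `ℂ[x, y]^G` is isomorphic to the quotient by this determinantal ideal.

Variables of the polynomial ring `MvPolynomial (Fin (n+1)) ℂ`: variable `0` is `a`,
variable `j` is `b_j` for `1 ≤ j ≤ n − 1`, and variable `n` is `c`.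
-/

open MvPolynomial

/-- First row `(a, b₁, …, b_{n−2}, b_{n−1}²)` of the 2×n matrix. -/
noncomputable def row1 (n : ℕ) (i : Fin n) : MvPolynomial (Fin (n + 1)) ℂ :=
  if (i : ℕ) = n - 1 then X (⟨n - 1, by omega⟩ : Fin (n + 1)) ^ 2
  else X (Fin.castSucc i)

/-- Second row `(b₁, b₂, …, b_{n−1}, c)` of the 2×n matrix. -/
noncomputable def row2 (n : ℕ) (i : Fin n) : MvPolynomial (Fin (n + 1)) ℂ :=
  X (⟨(i : ℕ) + 1, by omega⟩ : Fin (n + 1))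

/-- The ideal generated by the 2×2 minors of the above 2×n matrix. -/
noncomputable def minorsIdeal (n : ℕ) : Ideal (MvPolynomial (Fin (n + 1)) ℂ) :=
  Ideal.span {q | ∃ i j : Fin n, i < j ∧
    q = row1 n i * row2 n j - row1 n j * row2 n i}

theorem km_swap {R : Type*} [CommRing R] (n : ℕ) (z : ℕ → R)
    (h1 : ∀ i j, i + 1 < n → j + 1 < n → z i * z (j + 1) = z j * z (i + 1)) (d : ℕ) :
    ∀ i j, i + d < n → j + d < n → z i * z (j + d) = z (i + d) * z j := by
  induction d with
  | zero => intro i j _ _; rfl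
  | succ d ih =>
    intro i j hi hj
    have e1 := h1 i (j + d) (by omega) (by omega)
    have e2 := ih (i + 1) j (by omega) (by omega)
    rw [← add_assoc, e1, mul_comm, e2]
    congr 2
    omega

theorem km_swap' {R : Type*} [CommRing R] (n : ℕ) (z : ℕ → R)
    (h1 : ∀ i j, i + 1 < n → j + 1 < n → z i * z (j + 1) = z j * z (i + 1))
    (i j f : ℕ) (hif : i < f) (hfj : f < j) (hj : j < n) :
    z i * z j = z f * z (i + j - f) := by
  have := km_swap n z h1 (f - i) i (i + j - f) (by omega) (by omega)
  rwa [show i + j - f + (f - i) = j by omega, show i + (f - i) = f by omega] at this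

theorem km_bring {R : Type*} [CommRing R] (n : ℕ) (z : ℕ → R)
    (h1 : ∀ i j, i + 1 < n → j + 1 < n → z i * z (j + 1) = z j * z (i + 1))
    (S : Multiset ℕ) (hS : ∀ i ∈ S, i < n) (f : ℕ)
    (hf1 : S.card * f ≤ S.sum) (hf2 : S.sum < S.card * (f + 1)) :
    ∃ S' : Multiset ℕ, (S.map z).prod = z f * (S'.map z).prod ∧ S'.card + 1 = S.card ∧
      (∀ i ∈ S', i < n) ∧ f + S'.sum = S.sum := by
  by_cases hm : f ∈ S
  · obtain ⟨T, rfl⟩ := Multiset.exists_cons_of_mem hm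
    exact ⟨T, by simp, by simp, fun i hi => hS i (Multiset.mem_cons_of_mem hi), by simp⟩
  have hpos : 0 < S.card := by
    rcases Nat.eq_zero_or_pos S.card with h | h
    · rw [h] at hf2; omega
    · exact h
  have hi : ∃ i ∈ S, i < f := by
    by_contra! hc
    have := Multiset.card_nsmul_le_sum (s := S) (a := f + 1) (fun x hx => by
      have := hc x hx
      have : x ≠ f := fun e => hm (e ▸ hx)
      omega)
    simp only [smul_eq_mul] at this
    omega
  have hj : ∃ j ∈ S, f < j := by
    by_contra! hc
    obtain ⟨i, hi, hif⟩ := hi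
    obtain ⟨T, rfl⟩ := Multiset.exists_cons_of_mem hi
    have := Multiset.sum_le_card_nsmul T f (fun x hx => hc x (Multiset.mem_cons_of_mem hx))
    simp only [smul_eq_mul, Multiset.card_cons, Multiset.sum_cons, add_mul] at *
    omega
  obtain ⟨i, hi, hif⟩ := hi
  obtain ⟨j, hj, hfj⟩ := hj
  obtain ⟨T, rfl⟩ := Multiset.exists_cons_of_mem hi
  have hj' : j ∈ T := by
    rcases Multiset.mem_cons.1 hj with h | h
    · omega
    · exact h
  obtain ⟨U, rfl⟩ := Multiset.exists_cons_of_mem hj'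
  have hjn := hS j hj
  refine ⟨(i + j - f) ::ₘ U, ?_, by simp, ?_, ?_⟩
  · simp only [Multiset.map_cons, Multiset.prod_cons]
    rw [← mul_assoc, ← mul_assoc, km_swap' n z h1 i j f hif hfj hjn]
  · intro x hx
    rcases Multiset.mem_cons.1 hx with h | h
    · omega
    · exact hS x (by simp [h])
  · simp only [Multiset.sum_cons]; omega

theorem km_free {R : Type*} [CommRing R] (n : ℕ) (z : ℕ → R)
    (h1 : ∀ i j, i + 1 < n → j + 1 < n → z i * z (j + 1) = z j * z (i + 1)) (k : ℕ) :
    ∀ S T : Multiset ℕ, S.card = k → T.card = k → (∀ i ∈ S, i < n) → (∀ i ∈ T, i < n) →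
      S.sum = T.sum → (S.map z).prod = (T.map z).prod := by
  induction k with
  | zero =>
    intro S T hS hT _ _ _
    rw [Multiset.card_eq_zero.1 hS, Multiset.card_eq_zero.1 hT]
  | succ k ih =>
    intro S T hS hT hSn hTn hs
    have b1 : (k + 1) * (S.sum / (k + 1)) ≤ S.sum := Nat.mul_div_le _ _
    have b2 : S.sum < (k + 1) * (S.sum / (k + 1) + 1) := Nat.lt_mul_div_succ _ (by omega)
    obtain ⟨S', p1, c1, l1, s1⟩ := km_bring n z h1 S hSn (S.sum / (k + 1)) (by rwa [hS]) (by rwa [hS])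
    obtain ⟨T', p2, c2, l2, s2⟩ := km_bring n z h1 T hTn (S.sum / (k + 1))
      (by rw [hT, ← hs]; exact b1) (by rw [hT, ← hs]; exact b2)
    rw [p1, p2, ih S' T' (by omega) (by omega) l1 l2 (by omega)]

/-- weight -/
def kmW (n : ℕ) (i : ℕ) : ℕ := if i = n then 2 else 1
/-- y-degree -/
def kmQ (n : ℕ) (i : ℕ) : ℕ := if i = n then 2 * n - 1 else i
/-- x-degree -/
def kmP (n : ℕ) (i : ℕ) : ℕ := if i = n then 0 else 2 * n - 1 - 2 * i

theorem km_map_free (n : ℕ) (S : Multiset ℕ) (hS : ∀ i ∈ S, i < n) :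
    (S.map (kmW n)).sum = S.card ∧ (S.map (kmQ n)).sum = S.sum := by
  constructor
  · rw [Multiset.map_congr rfl (g := fun _ => 1)]
    · simp
    · intro x hx; have := hS x hx; simp [kmW]; omega
  · rw [Multiset.map_congr rfl (g := id)]
    · simp
    · intro x hx; have := hS x hx; simp [kmQ]; omega

theorem km_tofree {R : Type*} [CommRing R] (n : ℕ) (hn : 3 ≤ n) (z : ℕ → R)
    (h2 : ∀ i, i + 1 < n → z i * z n = z (n - 1) ^ 2 * z (i + 1)) (k : ℕ) :
    ∀ S : Multiset ℕ, S.count n = k → (∀ i ∈ S, i ≤ n) →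
      (S.map (kmQ n)).sum ≤ (n - 1) * (S.map (kmW n)).sum →
      ∃ S' : Multiset ℕ, (∀ i ∈ S', i < n) ∧ (S.map z).prod = (S'.map z).prod ∧
        (S'.map (kmQ n)).sum = (S.map (kmQ n)).sum ∧
        (S'.map (kmW n)).sum = (S.map (kmW n)).sum := by
  induction k with
  | zero =>
    intro S hc hS _
    refine ⟨S, fun i hi => ?_, rfl, rfl, rfl⟩
    have := hS i hi
    have : i ≠ n := fun e => Multiset.count_eq_zero.1 hc (e ▸ hi)
    omega
  | succ k ih =>
    intro S hc hS hq
    have hmem : n ∈ S := Multiset.count_pos.1 (by omega)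
    obtain ⟨T, rfl⟩ := Multiset.exists_cons_of_mem hmem
    have hi : ∃ i ∈ T, i + 1 < n := by
      by_contra! hcon
      have : (n - 1) * (T.map (kmW n)).sum ≤ (T.map (kmQ n)).sum := by
        rw [← Multiset.sum_map_mul_left]
        apply Multiset.sum_map_le_sum_map
        intro i hi
        have a1 := hcon i hi
        have a2 := hS i (Multiset.mem_cons_of_mem hi)
        unfold kmW kmQ
        split_ifs <;> omega
      simp only [Multiset.map_cons, Multiset.sum_cons, mul_add] at hq
      simp only [kmQ, kmW, if_true] at hq this
      omega
    obtain ⟨i, hi, hin⟩ := hi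
    obtain ⟨U, rfl⟩ := Multiset.exists_cons_of_mem hi
    have hcount : Multiset.count n ((n - 1) ::ₘ (n - 1) ::ₘ (i + 1) ::ₘ U) = k := by
      rw [Multiset.count_cons_self, Multiset.count_cons_of_ne (by omega)] at hc
      rw [Multiset.count_cons_of_ne (by omega), Multiset.count_cons_of_ne (by omega),
        Multiset.count_cons_of_ne (by omega)]
      omega
    have hQ : (((n - 1) ::ₘ (n - 1) ::ₘ (i + 1) ::ₘ U).map (kmQ n)).sum =
        ((n ::ₘ i ::ₘ U).map (kmQ n)).sum := by
      simp only [Multiset.map_cons, Multiset.sum_cons, kmQ]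
      rw [if_neg (show ¬ n - 1 = n by omega), if_neg (show ¬ i + 1 = n by omega), if_pos trivial,
        if_neg (show ¬ i = n by omega)]; omega
    have hW : (((n - 1) ::ₘ (n - 1) ::ₘ (i + 1) ::ₘ U).map (kmW n)).sum =
        ((n ::ₘ i ::ₘ U).map (kmW n)).sum := by
      simp only [Multiset.map_cons, Multiset.sum_cons, kmW]
      rw [if_neg (show ¬ n - 1 = n by omega), if_neg (show ¬ i + 1 = n by omega), if_pos trivial,
        if_neg (show ¬ i = n by omega)]; omega
    obtain ⟨S', l, p, q, w⟩ := ih _ hcount (by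
      intro x hx
      simp only [Multiset.mem_cons] at hx
      rcases hx with h | h | h | h
      · omega
      · omega
      · omega
      · exact hS x (by simp [h])) (by rw [hQ, hW]; exact hq)
    refine ⟨S', l, ?_, q.trans hQ, w.trans hW⟩
    rw [← p]
    simp only [Multiset.map_cons, Multiset.prod_cons]
    linear_combination (U.map z).prod * h2 i hin

theorem km_mem {n : ℕ} (hn : 3 ≤ n) (S : Multiset ℕ) (hS : ∀ i ∈ S, i ≤ n)
    (hq : (n - 1) * (S.map (kmW n)).sum < (S.map (kmQ n)).sum) : n ∈ S := by
  by_contra hm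
  have : (S.map (kmQ n)).sum ≤ (n - 1) * (S.map (kmW n)).sum := by
    rw [← Multiset.sum_map_mul_left]
    apply Multiset.sum_map_le_sum_map
    intro i hi
    have a2 := hS i hi
    have : i ≠ n := fun e => hm (e ▸ hi)
    unfold kmW kmQ
    rw [if_neg this, if_neg this]
    omega
  omega

theorem km_main {R : Type*} [CommRing R] (n : ℕ) (hn : 3 ≤ n) (z : ℕ → R)
    (h1 : ∀ i j, i + 1 < n → j + 1 < n → z i * z (j + 1) = z j * z (i + 1))
    (h2 : ∀ i, i + 1 < n → z i * z n = z (n - 1) ^ 2 * z (i + 1)) (k : ℕ) :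
    ∀ S T : Multiset ℕ, S.card = k → (∀ i ∈ S, i ≤ n) → (∀ i ∈ T, i ≤ n) →
      (S.map (kmQ n)).sum = (T.map (kmQ n)).sum → (S.map (kmW n)).sum = (T.map (kmW n)).sum →
      (S.map z).prod = (T.map z).prod := by
  induction k with
  | zero =>
    intro S T hS _ hT _ hW
    obtain rfl := Multiset.card_eq_zero.1 hS
    have : T = 0 := by
      by_contra hne
      obtain ⟨i, hi⟩ := Multiset.exists_mem_of_ne_zero hne
      obtain ⟨U, rfl⟩ := Multiset.exists_cons_of_mem hi
      simp only [Multiset.map_cons, Multiset.sum_cons, Multiset.map_zero, Multiset.sum_zero] at hW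
      unfold kmW at hW
      split_ifs at hW <;> omega
    rw [this]
  | succ k ih =>
    intro S T hk hS hT hQ hW
    by_cases hq : (S.map (kmQ n)).sum ≤ (n - 1) * (S.map (kmW n)).sum
    · obtain ⟨S', l1, p1, q1, w1⟩ := km_tofree n hn z h2 _ S rfl hS hq
      obtain ⟨T', l2, p2, q2, w2⟩ := km_tofree n hn z h2 _ T rfl hT (by rw [← hQ, ← hW]; exact hq)
      have a1 := km_map_free n S' l1
      have a2 := km_map_free n T' l2
      rw [p1, p2]
      exact km_free n z h1 _ S' T' rfl (by omega) l1 l2 (by omega)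
    · obtain ⟨S', rfl⟩ := Multiset.exists_cons_of_mem (km_mem hn S hS (by omega))
      obtain ⟨T', rfl⟩ := Multiset.exists_cons_of_mem (km_mem hn T hT (by rw [← hQ, ← hW]; omega))
      simp only [Multiset.map_cons, Multiset.sum_cons, Multiset.prod_cons, Multiset.card_cons] at *
      rw [ih S' T' (by omega) (fun i hi => hS i (by simp [hi])) (fun i hi => hT i (by simp [hi]))
        (by omega) (by omega)]

theorem km_PQW (n : ℕ) (hn : 3 ≤ n) (S : Multiset ℕ) (hS : ∀ i ∈ S, i ≤ n) :
    (S.map (kmP n)).sum + 2 * (S.map (kmQ n)).sum = (2 * n - 1) * (S.map (kmW n)).sum := by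
  rw [← Multiset.sum_map_mul_left, ← Multiset.sum_map_mul_left, ← Multiset.sum_map_add]
  congr 1
  apply Multiset.map_congr rfl
  intro i hi
  have := hS i hi
  unfold kmP kmQ kmW
  split_ifs <;> omega

theorem km_exists (n : ℕ) (hn : 3 ≤ n) (k : ℕ) : ∀ p q : ℕ, p + 2 * q = (2 * n - 1) * k →
    ∃ S : Multiset ℕ, (∀ i ∈ S, i ≤ n) ∧ (S.map (kmP n)).sum = p ∧ (S.map (kmQ n)).sum = q := by
  induction k using Nat.strong_induction_on with
  | _ k ih =>
  intro p q h
  have key : ∀ i k', i ≤ n → kmW n i + k' = k → kmP n i ≤ p → kmQ n i ≤ q →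
     ∃ S : Multiset ℕ, (∀ i ∈ S, i ≤ n) ∧ (S.map (kmP n)).sum = p ∧ (S.map (kmQ n)).sum = q := by
    intro i k' hi hk hp hq
    have e := km_PQW n hn {i} (by simpa using hi)
    simp only [Multiset.map_singleton, Multiset.sum_singleton] at e
    rw [← hk, mul_add] at h
    obtain ⟨S, a, b, c⟩ := ih k' (by unfold kmW at hk; split_ifs at hk <;> omega)
      (p - kmP n i) (q - kmQ n i) (by omega)
    refine ⟨i ::ₘ S, ?_, ?_, ?_⟩
    · intro x hx
      rcases Multiset.mem_cons.1 hx with h | h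
      · omega
      · exact a x h
    · simp [b]; omega
    · simp [c]; omega
  rcases Nat.eq_zero_or_pos k with rfl | hk
  · exact ⟨0, by simp, by simp; omega, by simp; omega⟩
  have hk1 : 2 * n - 1 ≤ (2 * n - 1) * k := Nat.le_mul_of_pos_right _ hk
  rcases Nat.lt_or_ge q n with hq | hq
  · exact key q (k - 1) hq.le (by simp [kmW]; split_ifs <;> omega)
      (by simp [kmP]; split_ifs <;> omega) (by simp [kmQ]; split_ifs <;> omega)
  rcases Nat.eq_zero_or_pos p with rfl | hp
  · have hk2 : 2 ≤ k := by
      by_contra hc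
      have : k = 1 := by omega
      subst this
      omega
    have : (2 * n - 1) * 2 ≤ (2 * n - 1) * k := Nat.mul_le_mul_left _ hk2
    exact key n (k - 2) le_rfl (by simp [kmW]; omega) (by simp [kmP]) (by simp [kmQ]; omega)
  · exact key (n - 1) (k - 1) (by omega) (by simp [kmW]; split_ifs <;> omega)
      (by simp [kmP]; split_ifs <;> omega) (by simp [kmQ]; split_ifs <;> omega)

/-- variables indexed by naturals -/
noncomputable def kmZ (n : ℕ) (i : ℕ) : MvPolynomial (Fin (n + 1)) ℂ :=
  if h : i < n + 1 then X ⟨i, h⟩ else 0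

theorem km_row1_lt (n : ℕ) (i : Fin n) (hi : (i : ℕ) + 1 < n) : row1 n i = kmZ n i := by
  unfold row1 kmZ
  rw [if_neg (by omega), dif_pos (by omega)]
  rfl

theorem km_row1_last (n : ℕ) (i : Fin n) (hi : (i : ℕ) + 1 = n) :
    row1 n i = kmZ n (n - 1) ^ 2 := by
  unfold row1 kmZ
  rw [if_pos (by omega), dif_pos (by omega)]

theorem km_row2 (n : ℕ) (i : Fin n) : row2 n i = kmZ n (i + 1) := by
  unfold row2 kmZ
  rw [dif_pos (by omega)]

theorem km_minor (n : ℕ) (i j : Fin n) (hij : i < j) :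
    Ideal.Quotient.mk (minorsIdeal n) (row1 n i * row2 n j) =
    Ideal.Quotient.mk (minorsIdeal n) (row1 n j * row2 n i) := by
  rw [Ideal.Quotient.eq]
  exact Ideal.subset_span ⟨i, j, hij, rfl⟩

theorem km_rel1 (n : ℕ) (i j : ℕ) (hi : i + 1 < n) (hj : j + 1 < n) :
    Ideal.Quotient.mk (minorsIdeal n) (kmZ n i) * Ideal.Quotient.mk (minorsIdeal n) (kmZ n (j + 1)) =
    Ideal.Quotient.mk (minorsIdeal n) (kmZ n j) * Ideal.Quotient.mk (minorsIdeal n) (kmZ n (i + 1)) := by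
  rw [← map_mul, ← map_mul]
  have key : ∀ i j : ℕ, i + 1 < n → j + 1 < n → i < j →
      Ideal.Quotient.mk (minorsIdeal n) (kmZ n i * kmZ n (j + 1)) =
      Ideal.Quotient.mk (minorsIdeal n) (kmZ n j * kmZ n (i + 1)) := by
    intro i j hi hj hij
    have := km_minor n ⟨i, by omega⟩ ⟨j, by omega⟩ hij
    rwa [km_row1_lt _ _ hi, km_row1_lt _ _ hj, km_row2, km_row2] at this
  rcases lt_trichotomy i j with h | h | h
  · exact key i j hi hj h
  · rw [h]
  · exact (key j i hj hi h).symm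

theorem km_rel2 (n : ℕ) (i : ℕ) (hi : i + 1 < n) :
    Ideal.Quotient.mk (minorsIdeal n) (kmZ n i) * Ideal.Quotient.mk (minorsIdeal n) (kmZ n n) =
    Ideal.Quotient.mk (minorsIdeal n) (kmZ n (n - 1)) ^ 2 *
      Ideal.Quotient.mk (minorsIdeal n) (kmZ n (i + 1)) := by
  rw [← map_mul, ← map_pow, ← map_mul]
  have := km_minor n ⟨i, by omega⟩ ⟨n - 1, by omega⟩ (Fin.mk_lt_mk.2 (by omega))
  rw [km_row1_lt _ _ hi, km_row1_last _ _ (by simp; omega), km_row2, km_row2] at this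
  rwa [show ((⟨n - 1, by omega⟩ : Fin n) : ℕ) + 1 = n by simp; omega] at this

theorem km_monomial (n : ℕ) (u : Fin (n + 1) →₀ ℕ) :
    ∃ S : Multiset ℕ, (∀ i ∈ S, i ≤ n) ∧ monomial u (1 : ℂ) = (S.map (kmZ n)).prod := by
  induction u using Finsupp.induction_linear with
  | zero => exact ⟨0, by simp, by simp⟩
  | add u v hu hv =>
    obtain ⟨S, hS, eS⟩ := hu
    obtain ⟨T, hT, eT⟩ := hv
    refine ⟨S + T, ?_, ?_⟩
    · intro i hi
      rcases Multiset.mem_add.1 hi with h | h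
      · exact hS i h
      · exact hT i h
    · rw [Multiset.map_add, Multiset.prod_add, ← eS, ← eT, monomial_mul, one_mul]
  | single i k =>
    refine ⟨Multiset.replicate k i, ?_, ?_⟩
    · intro x hx
      rw [Multiset.eq_of_mem_replicate hx]
      omega
    · rw [Multiset.map_replicate, Multiset.prod_replicate, kmZ, dif_pos i.2, X_pow_eq_monomial]

theorem km_phi (n : ℕ) (φ : MvPolynomial (Fin (n + 1)) ℂ →ₐ[ℂ] MvPolynomial (Fin 2) ℂ)
    (h : ∀ i ≤ n, φ (kmZ n i) = X 0 ^ kmP n i * X 1 ^ kmQ n i)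
    (S : Multiset ℕ) (hS : ∀ i ∈ S, i ≤ n) :
    φ ((S.map (kmZ n)).prod) = X 0 ^ (S.map (kmP n)).sum * X 1 ^ (S.map (kmQ n)).sum := by
  induction S using Multiset.induction_on with
  | empty => simp
  | cons a S ih =>
    simp only [Multiset.map_cons, Multiset.prod_cons, Multiset.sum_cons, map_mul]
    rw [h a (hS a (by simp)), ih (fun i hi => hS i (by simp [hi]))]
    ring

theorem km_mon2 (p q : ℕ) : (X 0 ^ p * X 1 ^ q : MvPolynomial (Fin 2) ℂ) =
    monomial (Finsupp.single 0 p + Finsupp.single 1 q) 1 := by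
  rw [X_pow_eq_monomial, X_pow_eq_monomial, monomial_mul, one_mul]

open Classical in
/-- the inverse linear map -/
noncomputable def kmPsi (n : ℕ) :
    MvPolynomial (Fin 2) ℂ →ₗ[ℂ] (MvPolynomial (Fin (n + 1)) ℂ ⧸ minorsIdeal n) :=
  (basisMonomials (Fin 2) ℂ).constr ℂ (fun e =>
    if h : ∃ S : Multiset ℕ, (∀ i ∈ S, i ≤ n) ∧ (S.map (kmP n)).sum = e 0 ∧
      (S.map (kmQ n)).sum = e 1 then
      Ideal.Quotient.mk (minorsIdeal n) ((h.choose.map (kmZ n)).prod) else 0)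

theorem km_psi (n : ℕ) (hn : 3 ≤ n) (S : Multiset ℕ) (hS : ∀ i ∈ S, i ≤ n) :
    kmPsi n (X 0 ^ (S.map (kmP n)).sum * X 1 ^ (S.map (kmQ n)).sum) =
      Ideal.Quotient.mk (minorsIdeal n) ((S.map (kmZ n)).prod) := by
  rw [km_mon2, ← congrFun (coe_basisMonomials (Fin 2) ℂ)]
  unfold kmPsi
  rw [Module.Basis.constr_basis]
  have h : ∃ T : Multiset ℕ, (∀ i ∈ T, i ≤ n) ∧ (T.map (kmP n)).sum =
      (Finsupp.single (0 : Fin 2) (S.map (kmP n)).sum +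
        Finsupp.single 1 (S.map (kmQ n)).sum : Fin 2 →₀ ℕ) 0 ∧
      (T.map (kmQ n)).sum =
      (Finsupp.single (0 : Fin 2) (S.map (kmP n)).sum +
        Finsupp.single 1 (S.map (kmQ n)).sum : Fin 2 →₀ ℕ) 1 :=
    ⟨S, hS, by simp, by simp⟩
  rw [dif_pos h]
  obtain ⟨a, b, c⟩ := h.choose_spec
  generalize h.choose = T at a b c
  simp at b c
  have e1 := km_PQW n hn S hS
  have e2 := km_PQW n hn T a
  rw [b, c, e1] at e2
  have e3 := Nat.eq_of_mul_eq_mul_left (by omega) e2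
  rw [map_multiset_prod, map_multiset_prod, Multiset.map_map, Multiset.map_map]
  exact km_main n hn (fun i => Ideal.Quotient.mk (minorsIdeal n) (kmZ n i)) (km_rel1 n)
    (km_rel2 n) _ T S rfl a hS c e3.symm

theorem km_left_inv (n : ℕ) (hn : 3 ≤ n)
    (φ : MvPolynomial (Fin (n + 1)) ℂ →ₐ[ℂ] MvPolynomial (Fin 2) ℂ)
    (h : ∀ i ≤ n, φ (kmZ n i) = X 0 ^ kmP n i * X 1 ^ kmQ n i) (f : MvPolynomial (Fin (n + 1)) ℂ) :
    kmPsi n (φ f) = Ideal.Quotient.mk (minorsIdeal n) f := by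
  have : (kmPsi n).comp φ.toLinearMap = (Ideal.Quotient.mkₐ ℂ (minorsIdeal n)).toLinearMap := by
    apply (basisMonomials (Fin (n + 1)) ℂ).ext
    intro u
    obtain ⟨S, hS, e⟩ := km_monomial n u
    simp only [coe_basisMonomials, LinearMap.comp_apply, AlgHom.toLinearMap_apply, e]
    rw [km_phi n φ h S hS, km_psi n hn S hS]
    rfl
  exact LinearMap.congr_fun this f

theorem km_sigma (ε : ℂ) (σ : MvPolynomial (Fin 2) ℂ →ₐ[ℂ] MvPolynomial (Fin 2) ℂ)
    (hσx : σ (X 0) = C ε * X 0) (hσy : σ (X 1) = C (ε ^ 2) * X 1) (e : Fin 2 →₀ ℕ) (c : ℂ) :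
    σ (monomial e c) = monomial e (ε ^ (e 0 + 2 * e 1) * c) := by
  have h : ∀ c : ℂ, monomial e c = C c * (X 0 ^ e 0 * X 1 ^ e 1) := by
    intro c
    rw [monomial_eq, Finsupp.prod_fintype _ _ (by simp), Fin.prod_univ_two]
  rw [h, h]
  have hC : ∀ c : ℂ, σ (C c) = C c := fun c => σ.commutes c
  simp only [map_mul, map_pow, hσx, hσy, hC]
  ring

theorem km_sigma_coeff (ε : ℂ) (σ : MvPolynomial (Fin 2) ℂ →ₐ[ℂ] MvPolynomial (Fin 2) ℂ)
    (hσx : σ (X 0) = C ε * X 0) (hσy : σ (X 1) = C (ε ^ 2) * X 1) (e : Fin 2 →₀ ℕ)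
    (f : MvPolynomial (Fin 2) ℂ) :
    coeff e (σ f) = ε ^ (e 0 + 2 * e 1) * coeff e f := by
  induction f using MvPolynomial.induction_on' with
  | monomial u a =>
    rw [km_sigma ε σ hσx hσy, coeff_monomial, coeff_monomial]
    split_ifs with h
    · rw [h]
    · simp
  | add p q hp hq => rw [map_add, coeff_add, coeff_add, hp, hq, mul_add]

theorem kernel_eq_minors_ideal
    (n : ℕ) (hn : 3 ≤ n) (m : ℕ) (hm : m = 2 * n - 1)
    (ε : ℂ) (hε : IsPrimitiveRoot ε m)
    (σ : MvPolynomial (Fin 2) ℂ →ₐ[ℂ] MvPolynomial (Fin 2) ℂ)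
    (hσx : σ (X 0) = C ε * X 0)
    (hσy : σ (X 1) = C (ε ^ 2) * X 1)
    (φ : MvPolynomial (Fin (n + 1)) ℂ →ₐ[ℂ] MvPolynomial (Fin 2) ℂ)
    (hφa : φ (X 0) = X 0 ^ m)
    (hφb : ∀ (j : ℕ) (h1 : 1 ≤ j) (h2 : j ≤ n - 1),
      φ (X (⟨j, by omega⟩ : Fin (n + 1))) = X 0 ^ (m - 2 * j) * X 1 ^ j)
    (hφc : φ (X (⟨n, by omega⟩ : Fin (n + 1))) = X 1 ^ m) :
    RingHom.ker φ = minorsIdeal n ∧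
    Nonempty ((MvPolynomial (Fin (n + 1)) ℂ ⧸ minorsIdeal n) ≃ₐ[ℂ]
      (AlgHom.equalizer σ (AlgHom.id ℂ (MvPolynomial (Fin 2) ℂ)))) := by
  have hZ : ∀ i ≤ n, φ (kmZ n i) = X 0 ^ kmP n i * X 1 ^ kmQ n i := by
    intro i hi
    unfold kmZ kmP kmQ
    rw [dif_pos (by omega)]
    by_cases h : i = n
    · subst h
      rw [hφc, if_pos rfl, if_pos rfl, hm]; simp
    · rw [if_neg h, if_neg h]
      rcases Nat.eq_zero_or_pos i with rfl | h0
      · have : (⟨0, by omega⟩ : Fin (n + 1)) = 0 := rfl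
        rw [this, hφa, hm]; simp
      · rw [hφb i h0 (by omega), hm]
  have hker : RingHom.ker φ = minorsIdeal n := by
    apply le_antisymm
    · intro f hf
      have := km_left_inv n hn φ hZ f
      rw [(RingHom.mem_ker).1 hf, map_zero] at this
      exact Ideal.Quotient.eq_zero_iff_mem.1 this.symm
    · apply Ideal.span_le.2
      rintro _ ⟨i, j, hij, rfl⟩
      have hij' : (i : ℕ) < j := hij
      have hj := j.2
      simp only [SetLike.mem_coe, RingHom.mem_ker, map_sub, map_mul, sub_eq_zero]
      rw [km_row1_lt n i (by omega), km_row2, km_row2]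
      by_cases h : (j : ℕ) + 1 = n
      · rw [km_row1_last n j h, map_pow, hZ _ (by omega), hZ _ (by omega), hZ _ (by omega),
          hZ _ (by omega), km_mon2, km_mon2, km_mon2, km_mon2, monomial_mul, monomial_pow,
          monomial_mul]
        simp only [one_pow, mul_one]
        refine congrArg (fun e => monomial e (1 : ℂ)) ?_
        ext t
        fin_cases t <;> simp [kmP, kmQ] <;> split_ifs <;> omega
      · rw [km_row1_lt n j (by omega), hZ _ (by omega), hZ _ (by omega), hZ _ (by omega),
          hZ _ (by omega), km_mon2, km_mon2, km_mon2, km_mon2, monomial_mul, monomial_mul]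
        simp only [one_pow, mul_one]
        refine congrArg (fun e => monomial e (1 : ℂ)) ?_
        ext t
        fin_cases t <;> simp [kmP, kmQ] <;> split_ifs <;> omega
  have hrange : φ.range = AlgHom.equalizer σ (AlgHom.id ℂ (MvPolynomial (Fin 2) ℂ)) := by
    apply le_antisymm
    · rintro _ ⟨f, rfl⟩
      have : σ.comp φ = φ := by
        apply MvPolynomial.algHom_ext
        intro i
        have hi : X i = kmZ n i := by rw [kmZ, dif_pos i.2]
        have e := km_PQW n hn {(i : ℕ)} (by simp; omega)
        simp only [Multiset.map_singleton, Multiset.sum_singleton] at e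
        rw [AlgHom.comp_apply, hi, hZ _ (by omega), km_mon2, km_sigma ε σ hσx hσy]
        simp [e, ← hm, pow_mul, hε.pow_eq_one]
      exact DFunLike.congr_fun this f
    · intro f hf
      have hf' : σ f = f := hf
      rw [f.as_sum]
      apply Subalgebra.sum_mem
      intro e he
      have hc := km_sigma_coeff ε σ hσx hσy e f
      rw [hf'] at hc
      have h1 : ε ^ (e 0 + 2 * e 1) = 1 := by
        have := mem_support_iff.1 he
        exact (mul_right_cancel₀ this (by rw [one_mul]; exact hc)).symm
      obtain ⟨k, hk⟩ := hε.dvd_of_pow_eq_one _ h1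
      rw [hm] at hk
      obtain ⟨S, hS, hp, hq⟩ := km_exists n hn k _ _ hk
      refine ⟨C (coeff e f) * (S.map (kmZ n)).prod, ?_⟩
      have hC : ∀ c : ℂ, φ (C c) = C c := fun c => φ.commutes c
      show φ _ = _
      rw [map_mul, hC, km_phi n φ hZ S hS, hp, hq, monomial_eq,
        Finsupp.prod_fintype _ _ (by simp), Fin.prod_univ_two]
  refine ⟨hker, ⟨?_⟩⟩
  exact ((Ideal.quotientEquivAlgOfEq ℂ hker.symm).trans
    (Ideal.quotientKerEquivRange φ)).trans (Subalgebra.equivOfEq _ _ hrange)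
end

section
/- Let n ≥ 3, m = 2n − 1, let R = ℂ[x, y]^G be the invariant ring of G = 1/m(1,2) acting on ℂ[x, y], set a = x^m and b₁ = x^{m−2}y in R, and let I = (a, b₁) be the ideal of R generated by a and b₁. Then the R-module I is reflexive (the natural map I → Hom_R(Hom_R(I, R), R) is an isomorphism), satisfies Ext¹_R(I, R) = 0, is indecomposable, and is not a projective R-module. -/
/-!
Statement 10: Let `R = ℂ[x, y]^G` be the invariant ring of `G = 1/m(1,2)` (`m = 2n − 1`,
`n ≥ 3`), realized as the fixed subalgebra of the generator `σ` of the cyclic group `G`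
acting by `x ↦ εx`, `y ↦ ε²y`.  Let `I = (a, b₁) ⊆ R` where `a = x^m`, `b₁ = x^{m−2}y`.
Then `I` is a reflexive `R`-module with `Ext¹_R(I, R) = 0`, it is indecomposable, and it
is not projective.
-/

open MvPolynomial CategoryTheory

theorem schanuel_ext {R M F P Y : Type} [CommRing R] [AddCommGroup M] [Module R M]
    [AddCommGroup F] [Module R F] [Module.Projective R F]
    [AddCommGroup P] [Module R P] [Module.Projective R P] [AddCommGroup Y] [Module R Y]
    (ρ : F →ₗ[R] M) (hρ : Function.Surjective ρ) (π : P →ₗ[R] M) (hπ : Function.Surjective π)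
    (h : ∀ g : LinearMap.ker ρ →ₗ[R] Y, ∃ g' : F →ₗ[R] Y, ∀ k, g' k.1 = g k)
    (f : LinearMap.ker π →ₗ[R] Y) : ∃ f' : P →ₗ[R] Y, ∀ k, f' k.1 = f k := by
  obtain ⟨α, hα⟩ := Module.projective_lifting_property π ρ hπ
  obtain ⟨β, hβ⟩ := Module.projective_lifting_property ρ π hρ
  have hα' : ∀ x, π (α x) = ρ x := fun x => LinearMap.congr_fun hα x
  have hβ' : ∀ x, ρ (β x) = π x := fun x => LinearMap.congr_fun hβ x
  obtain ⟨g', hg'⟩ := h (f ∘ₗ (α.restrict (p := LinearMap.ker ρ) (q := LinearMap.ker π)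
    (fun x hx => by simpa [hα'] using hx)))
  let δ : P →ₗ[R] LinearMap.ker π := (LinearMap.id - α ∘ₗ β).codRestrict _
    (fun x => by simp [hα', hβ'])
  refine ⟨g' ∘ₗ β + f ∘ₗ δ, fun k => ?_⟩
  have hk : β k.1 ∈ LinearMap.ker ρ := by simp [hβ']
  have := hg' ⟨β k.1, hk⟩
  simp only [LinearMap.add_apply, LinearMap.comp_apply] at this ⊢
  rw [this, ← map_add]
  congr 1
  ext
  simp [δ, LinearMap.restrict]

theorem ext_vanish {R M F Y : Type} [CommRing R] [AddCommGroup M] [Module R M]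
    [AddCommGroup F] [Module R F] [Module.Projective R F] [AddCommGroup Y] [Module R Y]
    (ρ : F →ₗ[R] M) (hρ : Function.Surjective ρ)
    (h : ∀ g : LinearMap.ker ρ →ₗ[R] Y, ∃ g' : F →ₗ[R] Y, ∀ k, g' k.1 = g k) :
    Subsingleton (extGroup R 1 (ModuleCat.of R M) (ModuleCat.of R Y)) := by
  let P := ProjectiveResolution.of (ModuleCat.of R M)
  have hP : Module.Projective R (P.complex.X 0) :=
    (IsProjective.iff_projective _).2 (P.projective 0)
  have key : Limits.IsZero (extGroup R 1 (ModuleCat.of R M) (ModuleCat.of R Y)) := by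
    refine Limits.IsZero.of_iso ?_ (P.isoExt 1 (ModuleCat.of R Y))
    rw [← HomologicalComplex.exactAt_iff_isZero_homology,
      HomologicalComplex.exactAt_iff' _ 0 1 2 (by simp) (by simp), ShortComplex.moduleCat_exact_iff]
    intro (f : P.complex.X 1 ⟶ ModuleCat.of R Y) hf
    replace hf : P.complex.d 2 1 ≫ f = 0 := hf
    let π : P.complex.X 0 →ₗ[R] M := (P.π.f 0).hom
    have hπ : Function.Surjective π := (ModuleCat.epi_iff_surjective (P.π.f 0)).1 inferInstance
    have e0 := (ShortComplex.moduleCat_exact_iff _).1 P.exact₀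
    have e1 := (ShortComplex.moduleCat_exact_iff _).1 (P.exact_succ 0)
    have z0 : ∀ x, π (P.complex.d 1 0 x) = 0 := fun x =>
      LinearMap.congr_fun (congrArg ModuleCat.Hom.hom P.complex_d_comp_π_f_zero) x
    let d : P.complex.X 1 →ₗ[R] LinearMap.ker π := (P.complex.d 1 0).hom.codRestrict _ z0
    have hd : Function.Surjective d := by
      rintro ⟨y, hy⟩
      obtain ⟨x, hx⟩ := e0 y hy
      exact ⟨x, Subtype.ext hx⟩
    have hk : LinearMap.ker d ≤ LinearMap.ker f.hom := by
      intro x hx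
      obtain ⟨z, hz⟩ := e1 x (congrArg Subtype.val (LinearMap.mem_ker.1 hx))
      have := LinearMap.congr_fun (congrArg ModuleCat.Hom.hom hf) z
      rw [LinearMap.mem_ker, ← hz]
      exact this
    obtain ⟨f0, hf0⟩ : ∃ f0 : LinearMap.ker π →ₗ[R] Y, ∀ x, f0 (d x) = f.hom x := by
      refine ⟨((LinearMap.ker d).liftQ f.hom hk) ∘ₗ
        (d.quotKerEquivOfSurjective hd).symm.toLinearMap, fun x => ?_⟩
      have : (d.quotKerEquivOfSurjective hd).symm (d x) = (LinearMap.ker d).mkQ x := by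
        rw [LinearEquiv.symm_apply_eq]; rfl
      simp only [LinearMap.comp_apply, LinearEquiv.coe_coe, this]
      simp
    obtain ⟨f', hf'⟩ := schanuel_ext ρ hρ π hπ h f0
    refine ⟨(ModuleCat.ofHom f' : P.complex.X 0 ⟶ ModuleCat.of R Y), ?_⟩
    show P.complex.d 1 0 ≫ ModuleCat.ofHom f' = f
    ext x
    exact (hf' (d x)).trans (hf0 x)
  exact ModuleCat.subsingleton_of_isZero key

set_option synthInstance.maxHeartbeats 1000000
set_option maxHeartbeats 2000000

/-- semi-invariants -/
noncomputable def Wc (σ : MvPolynomial (Fin 2) ℂ →ₐ[ℂ] MvPolynomial (Fin 2) ℂ)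
    (R : Subalgebra ℂ (MvPolynomial (Fin 2) ℂ)) (hR : ∀ f, f ∈ R ↔ σ f = f) (c : ℂ) :
    Submodule R (MvPolynomial (Fin 2) ℂ) where
  carrier := {f | σ f = C c * f}
  add_mem' := by
    intro f g hf hg
    simp only [Set.mem_ofPred_eq] at *
    rw [map_add, hf, hg]; ring
  zero_mem' := by simp
  smul_mem' := by
    intro r f hf
    simp only [Set.mem_ofPred_eq, Subalgebra.smul_def, smul_eq_mul] at *
    rw [map_mul, hf, (hR _).1 r.2]; ring

section
variable {σ : MvPolynomial (Fin 2) ℂ →ₐ[ℂ] MvPolynomial (Fin 2) ℂ}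
    {R : Subalgebra ℂ (MvPolynomial (Fin 2) ℂ)} {hR : ∀ f, f ∈ R ↔ σ f = f}

theorem mem_Wc {c : ℂ} {f : MvPolynomial (Fin 2) ℂ} : f ∈ Wc σ R hR c ↔ σ f = C c * f := Iff.rfl

theorem Wc_mul {c c' : ℂ} (h : c * c' = 1) {f g : MvPolynomial (Fin 2) ℂ}
    (hf : f ∈ Wc σ R hR c) (hg : g ∈ Wc σ R hR c') : f * g ∈ R := by
  rw [mem_Wc] at hf hg
  rw [hR, map_mul, hf, hg]
  calc C c * f * (C c' * g) = C (c * c') * (f * g) := by rw [C_mul]; ring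
    _ = f * g := by rw [h]; simp

theorem Wc_of_mul {c c' : ℂ} (h : c * c' = 1) {f g : MvPolynomial (Fin 2) ℂ} (hf0 : f ≠ 0)
    (hf : f ∈ Wc σ R hR c) (hfg : f * g ∈ R) : g ∈ Wc σ R hR c' := by
  rw [mem_Wc] at *
  rw [hR, map_mul, hf] at hfg
  apply mul_left_cancel₀ hf0
  calc f * σ g = C (c' * c) * (f * σ g) := by rw [mul_comm c', h]; simp
    _ = C c' * (C c * f * σ g) := by rw [C_mul]; ring
    _ = _ := by rw [hfg]; ring

theorem X_pow_dvd_of {i j : ℕ} {p q : MvPolynomial (Fin 2) ℂ} {u v : Fin 2} (huv : u ≠ v)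
    (h : p * X v ^ j = q * X u ^ i) :
    X u ^ i ∣ p := by
  have h1 : (X u : MvPolynomial (Fin 2) ℂ) ^ i ∣ p * X v ^ j := ⟨q, by rw [h]; ring⟩
  refine Prime.pow_dvd_of_dvd_mul_right X_prime i ?_ h1
  intro h2
  have h3 := (X_prime (R := ℂ) (i := u)).dvd_of_dvd_pow h2
  rw [X_dvd_X] at h3
  exact huv h3

theorem dual_rep {c c' : ℂ} (h : c * c' = 1) (i j : ℕ) (hi : X 0 ^ i ∈ Wc σ R hR c)
    (hj : X 1 ^ j ∈ Wc σ R hR c) {w : MvPolynomial (Fin 2) ℂ} (hw : w ∈ Wc σ R hR c') (hw0 : w ≠ 0)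
    (φ : Wc σ R hR c →ₗ[R] R) :
    ∃ s ∈ Wc σ R hR c', ∀ t : Wc σ R hR c, (φ t : MvPolynomial (Fin 2) ℂ) = s * t.1 := by
  have sym : ∀ t t' : Wc σ R hR c,
      (φ t : MvPolynomial (Fin 2) ℂ) * t'.1 = (φ t' : MvPolynomial (Fin 2) ℂ) * t.1 := by
    intro t t'
    have e : (⟨_, Wc_mul h t.2 hw⟩ : R) • t' = (⟨_, Wc_mul h t'.2 hw⟩ : R) • t := by
      ext1
      simp only [Submodule.coe_smul, Subalgebra.smul_def, smul_eq_mul]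
      ring
    have e2 := congrArg Subtype.val (congrArg φ e)
    simp only [map_smul, smul_eq_mul, MulMemClass.coe_mul] at e2
    apply mul_left_cancel₀ hw0
    linear_combination -e2
  obtain ⟨s, hs⟩ := X_pow_dvd_of (by decide) (sym ⟨_, hi⟩ ⟨_, hj⟩)
  have hx0 : (X 0 ^ i : MvPolynomial (Fin 2) ℂ) ≠ 0 := pow_ne_zero _ (X_ne_zero _)
  refine ⟨s, Wc_of_mul h hx0 hi (hs ▸ (φ ⟨_, hi⟩).2), fun t => ?_⟩
  have := sym t ⟨_, hi⟩
  apply mul_right_cancel₀ hx0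
  rw [this, hs]; ring

/-- the multiplication pairing -/
noncomputable def pairW {c c' : ℂ} (h : c * c' = 1) :
    Wc σ R hR c →ₗ[R] Wc σ R hR c' →ₗ[R] R :=
  LinearMap.mk₂ R (fun f g => ⟨f.1 * g.1, Wc_mul h f.2 g.2⟩)
    (fun a b c => Subtype.ext (add_mul _ _ _))
    (fun a b c => Subtype.ext (by
      simp only [Submodule.coe_smul, Subalgebra.smul_def, smul_eq_mul, MulMemClass.coe_mul]; ring))
    (fun a b c => Subtype.ext (mul_add _ _ _))
    (fun a b c => Subtype.ext (by
      simp only [Submodule.coe_smul, Subalgebra.smul_def, smul_eq_mul, MulMemClass.coe_mul]; ring))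

theorem pairW_bij {c c' : ℂ} (h : c * c' = 1) (i j : ℕ) (hi : X 0 ^ i ∈ Wc σ R hR c')
    (hj : X 1 ^ j ∈ Wc σ R hR c') {w : MvPolynomial (Fin 2) ℂ} (hw : w ∈ Wc σ R hR c)
    (hw0 : w ≠ 0) : Function.Bijective (pairW (hR := hR) h) := by
  have hx0 : (X 0 ^ i : MvPolynomial (Fin 2) ℂ) ≠ 0 := pow_ne_zero _ (X_ne_zero _)
  constructor
  · intro f g hfg
    have := congrArg Subtype.val (LinearMap.congr_fun hfg ⟨_, hi⟩)
    exact Subtype.ext (mul_right_cancel₀ hx0 this)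
  · intro φ
    obtain ⟨s, hs, hs'⟩ := dual_rep (by rwa [mul_comm]) i j hi hj hw hw0 φ
    refine ⟨⟨s, hs⟩, ?_⟩
    ext1 t
    exact Subtype.ext (hs' t).symm

theorem sigma_monomial {ε : ℂ} (hσx : σ (X 0) = C ε * X 0)
    (hσy : σ (X 1) = C (ε ^ 2) * X 1) (d : Fin 2 →₀ ℕ) (r : ℂ) :
    σ (monomial d r) = C (ε ^ (d 0 + 2 * d 1)) * monomial d r := by
  have : (monomial d r : MvPolynomial (Fin 2) ℂ) = C r * (X 0 ^ d 0 * X 1 ^ d 1) := by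
    rw [monomial_eq, Finsupp.prod_fintype _ _ (by simp)]; simp
  rw [this, map_mul, map_mul, map_pow, map_pow, hσx, hσy]
  have : σ (C r) = C r := σ.commutes r
  rw [this, mul_pow, mul_pow, pow_add, pow_mul]
  simp only [C_mul, C_pow]
  ring

theorem coeff_sigma {ε : ℂ} (hσx : σ (X 0) = C ε * X 0)
    (hσy : σ (X 1) = C (ε ^ 2) * X 1) (f : MvPolynomial (Fin 2) ℂ) (d : Fin 2 →₀ ℕ) :
    coeff d (σ f) = ε ^ (d 0 + 2 * d 1) * coeff d f := by
  induction f using MvPolynomial.induction_on' with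
  | monomial u a =>
    rw [sigma_monomial hσx hσy, coeff_C_mul, coeff_monomial]
    split_ifs with h
    · rw [h]
    · simp
  | add p q hp hq => simp only [map_add, coeff_add, hp, hq]; ring

theorem Wc_gen {ε : ℂ} {m : ℕ} (hm : 5 ≤ m) (hε : IsPrimitiveRoot ε m)
    (hσx : σ (X 0) = C ε * X 0)
    (hσy : σ (X 1) = C (ε ^ 2) * X 1) (f : MvPolynomial (Fin 2) ℂ)
    (hf : f ∈ Wc σ R hR (ε ^ 2)) : ∃ u v : R, f = X 0 ^ 2 * u.1 + X 1 * v.1 := by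
  have hc : ∀ d, coeff d f ≠ 0 → ε ^ (d 0 + 2 * d 1) = ε ^ 2 := by
    intro d hd
    have := coeff_sigma hσx hσy f d
    rw [mem_Wc.1 hf, coeff_C_mul] at this
    exact (mul_right_cancel₀ hd this).symm
  have hε0 : ε ≠ 0 := hε.ne_zero (by omega)
  have key : ∀ d r, ε ^ (d 0 + 2 * d 1) = ε ^ 2 →
      ∃ u v : R, (monomial d r : MvPolynomial (Fin 2) ℂ) = X 0 ^ 2 * u.1 + X 1 * v.1 := by
    intro d r hd
    have e : (monomial d r : MvPolynomial (Fin 2) ℂ) = C r * (X 0 ^ d 0 * X 1 ^ d 1) := by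
      rw [monomial_eq, Finsupp.prod_fintype _ _ (by simp)]; simp
    have hmem : ∀ g : MvPolynomial (Fin 2) ℂ, g ≠ 0 → ∀ h, h ∈ Wc σ R hR (ε^2) → h ≠ 0 →
      g * h = monomial d r → g ∈ R := by
      intro g hg h hh hh0 hgh
      rw [hR]
      have := sigma_monomial hσx hσy d r
      rw [← hgh, map_mul, mem_Wc.1 hh, hd] at this
      have hC : (C (ε^2) : MvPolynomial (Fin 2) ℂ) ≠ 0 := by simpa using hε0
      apply mul_right_cancel₀ (mul_ne_zero hC hh0)
      rw [this]; ring
    by_cases hr : r = 0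
    · exact ⟨0, 0, by simp [hr]⟩
    have hCr : (C r : MvPolynomial (Fin 2) ℂ) ≠ 0 := by simpa using hr
    by_cases h1 : d 1 = 0
    · have h2 : 2 ≤ d 0 := by
        by_contra hlt
        rw [h1] at hd
        have := hε.pow_inj (by omega) (by omega) hd
        omega
      obtain ⟨k, hk⟩ := Nat.exists_eq_add_of_le h2
      have e2 : (monomial d r : MvPolynomial (Fin 2) ℂ) = (C r * X 0 ^ k) * X 0 ^ 2 := by
        rw [e, h1, hk]; ring
      refine ⟨⟨C r * X 0 ^ k, hmem _ (mul_ne_zero hCr (pow_ne_zero _ (X_ne_zero _))) (X 0 ^ 2) ?_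
        (pow_ne_zero _ (X_ne_zero _)) e2.symm⟩, 0, ?_⟩
      · rw [mem_Wc, map_pow, hσx, C_pow]; ring
      · refine e2.trans ?_
        simp only [ZeroMemClass.coe_zero]; ring
    · obtain ⟨k, hk⟩ := Nat.exists_eq_succ_of_ne_zero h1
      have e2 : (monomial d r : MvPolynomial (Fin 2) ℂ) = (C r * X 0 ^ d 0 * X 1 ^ k) * X 1 := by
        rw [e, hk, Nat.succ_eq_add_one]; ring
      refine ⟨0, ⟨C r * X 0 ^ d 0 * X 1 ^ k, hmem _ (mul_ne_zero (mul_ne_zero hCr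
        (pow_ne_zero _ (X_ne_zero _))) (pow_ne_zero _ (X_ne_zero _))) (X 1) (mem_Wc.2 hσy)
        (X_ne_zero _) e2.symm⟩, ?_⟩
      refine e2.trans ?_
      simp only [ZeroMemClass.coe_zero]; ring
  choose u v huv using key
  have hs := f.as_sum
  rw [← Finset.sum_attach] at hs
  refine ⟨∑ d ∈ f.support.attach, u d.1 (coeff d.1 f) (hc d.1 (mem_support_iff.1 d.2)),
    ∑ d ∈ f.support.attach, v d.1 (coeff d.1 f) (hc d.1 (mem_support_iff.1 d.2)), ?_⟩
  conv_lhs => rw [hs]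
  simp only [AddSubmonoidClass.coe_finsetSum, Finset.mul_sum, ← Finset.sum_add_distrib]
  exact Finset.sum_congr rfl fun d _ => huv _ _ _

end

set_option synthInstance.maxHeartbeats 1000000 in
set_option maxHeartbeats 2000000 in
theorem special_CM_ideal_of_invariant_ring
    (n : ℕ) (hn : 3 ≤ n) (m : ℕ) (hm : m = 2 * n - 1)
    (ε : ℂ) (hε : IsPrimitiveRoot ε m)
    (σ : MvPolynomial (Fin 2) ℂ →ₐ[ℂ] MvPolynomial (Fin 2) ℂ)
    (hσx : σ (X 0) = C ε * X 0)
    (hσy : σ (X 1) = C (ε ^ 2) * X 1)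
    -- `R` is the invariant ring `ℂ[x,y]^G`, the fixed subalgebra of `σ`:
    (R : Subalgebra ℂ (MvPolynomial (Fin 2) ℂ))
    (hR : R = AlgHom.equalizer σ (AlgHom.id ℂ (MvPolynomial (Fin 2) ℂ)))
    -- `a = x^m` and `b₁ = x^{m-2} y` as elements of `R`:
    (a b₁ : R)
    (ha : (a : MvPolynomial (Fin 2) ℂ) = X 0 ^ m)
    (hb : (b₁ : MvPolynomial (Fin 2) ℂ) = X 0 ^ (m - 2) * X 1)
    -- `I` is the ideal of `R` generated by `a` and `b₁`:
    (I : Ideal R) (hI : I = Ideal.span {a, b₁}) :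
    -- `I` is reflexive:
    Function.Bijective (Module.Dual.eval R I) ∧
    -- `Ext¹_R(I, R) = 0`:
    Subsingleton (extGroup R 1 (ModuleCat.of R I) (ModuleCat.of R R)) ∧
    -- `I` is indecomposable:
    (Nontrivial I ∧ ∀ p q : Submodule R I, IsCompl p q → p = ⊥ ∨ q = ⊥) ∧
    -- `I` is not projective:
    ¬ Module.Projective R I := by
  have hR' : ∀ f, f ∈ R ↔ σ f = f := by
    intro f; rw [hR, AlgHom.mem_equalizer]; rfl
  clear hR
  have hm5 : 5 ≤ m := by omega
  have hε0 : ε ≠ 0 := hε.ne_zero (by omega)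
  have hxp : ∀ i, σ (X 0 ^ i) = C (ε ^ i) * X 0 ^ i := by
    intro i; rw [map_pow, hσx, C_pow]; ring
  have hyp : ∀ i, σ (X 1 ^ i) = C (ε ^ (2 * i)) * X 1 ^ i := by
    intro i; rw [map_pow, hσy, pow_mul, mul_pow, C_pow (ε ^ 2) i]
  have hmm : ε ^ (m - 2) * ε ^ 2 = 1 := by
    rw [← pow_add, Nat.sub_add_cancel (by omega), hε.pow_eq_one]
  have hmm' : ε ^ 2 * ε ^ (m - 2) = 1 := by rw [mul_comm, hmm]
  have hx0 : ∀ i, (X 0 ^ i : MvPolynomial (Fin 2) ℂ) ≠ 0 := fun i => pow_ne_zero _ (X_ne_zero _)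
  have mx2 : X 0 ^ 2 ∈ Wc σ R hR' (ε ^ 2) := mem_Wc.2 (hxp 2)
  have my1 : X 1 ∈ Wc σ R hR' (ε ^ 2) := mem_Wc.2 hσy
  have my1' : X 1 ^ 1 ∈ Wc σ R hR' (ε ^ 2) := by rwa [pow_one]
  have mxm : X 0 ^ (m - 2) ∈ Wc σ R hR' (ε ^ (m - 2)) := mem_Wc.2 (hxp _)
  have mym : X 1 ^ (m - 1) ∈ Wc σ R hR' (ε ^ (m - 2)) := by
    rw [mem_Wc, hyp, show 2 * (m - 1) = m + (m - 2) by omega, pow_add ε m, hε.pow_eq_one, one_mul]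
  have ha' : a.1 = X 0 ^ (m - 2) * X 0 ^ 2 := by
    rw [ha, ← pow_add, Nat.sub_add_cancel (by omega)]
  have ha0 : a ≠ 0 := by
    intro h; apply hx0 m; rw [← ha, h]; rfl
  -- the embedding of the semi-invariants
  let Θ : Wc σ R hR' (ε ^ 2) →ₗ[R] R := pairW (hR := hR') hmm ⟨_, mxm⟩
  have hΘ : ∀ f, (Θ f).1 = X 0 ^ (m - 2) * f.1 := fun f => rfl
  have hΘi : Function.Injective Θ := by
    intro f g hfg
    have := congrArg Subtype.val hfg
    rw [hΘ, hΘ] at this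
    exact Subtype.ext (mul_left_cancel₀ (hx0 _) this)
  have hΘr : LinearMap.range Θ = I := by
    apply le_antisymm
    · rintro _ ⟨f, rfl⟩
      obtain ⟨u, v, huv⟩ := Wc_gen hm5 hε hσx hσy f.1 f.2
      rw [hI, Ideal.mem_span_pair]
      refine ⟨u, v, Subtype.ext ?_⟩
      rw [hΘ, huv]
      simp only [AddMemClass.coe_add, MulMemClass.coe_mul]
      rw [ha', hb]; ring
    · rw [hI, Ideal.span, Submodule.span_le]
      rintro z (rfl | rfl)
      · exact ⟨⟨_, mx2⟩, Subtype.ext (by rw [hΘ, ha'])⟩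
      · exact ⟨⟨_, my1⟩, Subtype.ext (by rw [hΘ, hb])⟩
  have aI : a ∈ I := by rw [hI]; exact Ideal.subset_span (by simp)
  have bI : b₁ ∈ I := by rw [hI]; exact Ideal.subset_span (by simp)
  let e : Wc σ R hR' (ε ^ 2) ≃ₗ[R] I :=
    (LinearEquiv.ofInjective Θ hΘi).trans (LinearEquiv.ofEq _ _ hΘr)
  have he : ∀ f, ((e f : R) : MvPolynomial (Fin 2) ℂ) = X 0 ^ (m - 2) * f.1 := fun f => rfl
  let ρ : (R × R) →ₗ[R] I := LinearMap.coprod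
    (LinearMap.toSpanSingleton R I ⟨a, aI⟩) (LinearMap.toSpanSingleton R I ⟨b₁, bI⟩)
  have hρv : ∀ r s, (ρ (r, s)).1 = r * a + s * b₁ := fun r s => rfl
  have hρ : Function.Surjective ρ := by
    rintro ⟨z, hz⟩
    rw [hI, Ideal.mem_span_pair] at hz
    obtain ⟨r, s, hrs⟩ := hz
    exact ⟨(r, s), Subtype.ext hrs⟩
  refine ⟨?_, ?_, ⟨?_, ?_⟩, ?_⟩
  · have : LinearMap.IsPerfPair (R := R) (M := Wc σ R hR' (ε ^ 2))
        (N := Wc σ R hR' (ε ^ (m - 2))) (pairW (hR := hR') hmm') := by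
      refine ⟨pairW_bij hmm' (m - 2) (m - 1) mxm mym mx2 (hx0 _), ?_⟩
      have : (pairW (hR := hR') hmm').flip = pairW (hR := hR') hmm := by
        ext f g
        exact congrArg _ (mul_comm _ _)
      rw [this]
      exact pairW_bij hmm 2 1 mx2 my1' mxm (hx0 _)
    have h1 : Module.IsReflexive R (Wc σ R hR' (ε ^ 2)) :=
      Module.IsReflexive.of_isPerfPair (R := R) (M := Wc σ R hR' (ε ^ 2))
        (N := Wc σ R hR' (ε ^ (m - 2))) (pairW (hR := hR') hmm')
    have h2 : Module.IsReflexive R I := Module.equiv e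
    exact Module.bijective_dual_eval R I
  · refine ext_vanish ρ hρ fun g => ?_
    let T : Wc σ R hR' (ε ^ (m - 2)) →ₗ[R] R × R :=
      LinearMap.prod (pairW (hR := hR') hmm' ⟨_, my1⟩) (-pairW (hR := hR') hmm' ⟨_, mx2⟩)
    have hT : ∀ t, ρ (T t) = 0 := by
      intro t
      apply Subtype.ext
      apply Subtype.ext
      change X 1 * t.1 * a.1 + (-(X 0 ^ 2 * t.1)) * b₁.1 = 0
      rw [ha', hb]; ring
    let T' : Wc σ R hR' (ε ^ (m - 2)) →ₗ[R] LinearMap.ker ρ := T.codRestrict _ hT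
    obtain ⟨s, hs, hs'⟩ := dual_rep hmm (m - 2) (m - 1) mxm mym mx2 (hx0 _) (g ∘ₗ T')
    obtain ⟨u, v, huv⟩ := Wc_gen hm5 hε hσx hσy s hs
    refine ⟨LinearMap.coprod (LinearMap.toSpanSingleton R R v)
      (LinearMap.toSpanSingleton R R (-u)), ?_⟩
    rintro ⟨⟨p, q⟩, hpq⟩
    have h1 : p.1 * a.1 + q.1 * b₁.1 = 0 := congrArg (fun z : I => z.1.1) hpq
    have h2 : p.1 * X 0 ^ 2 = (-q.1) * X 1 ^ 1 := by
      apply mul_left_cancel₀ (hx0 (m - 2))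
      rw [ha', hb] at h1
      linear_combination h1
    obtain ⟨t, ht⟩ := X_pow_dvd_of (by decide) h2
    rw [pow_one] at ht
    have hy0 : (X 1 : MvPolynomial (Fin 2) ℂ) ≠ 0 := X_ne_zero _
    have htW : t ∈ Wc σ R hR' (ε ^ (m - 2)) := Wc_of_mul hmm' hy0 my1 (ht ▸ p.2)
    have hq : q.1 = -(X 0 ^ 2 * t) := by
      apply mul_left_cancel₀ hy0
      rw [ht] at h2
      linear_combination h2
    have h3 : T' ⟨t, htW⟩ = ⟨(p, q), hpq⟩ := by
      apply Subtype.ext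
      exact Prod.ext (Subtype.ext ht.symm) (Subtype.ext hq.symm)
    have h4 := hs' ⟨t, htW⟩
    rw [LinearMap.comp_apply, h3] at h4
    apply Subtype.ext
    rw [h4]
    change p.1 * v.1 + q.1 * (-u.1) = s * t
    rw [huv, ht, hq]; ring
  · exact ⟨⟨⟨a, aI⟩, 0, fun h => ha0 (congrArg Subtype.val h)⟩⟩
  · intro p q hpq
    by_contra hcon
    push Not at hcon
    obtain ⟨h1, h2⟩ := hcon
    obtain ⟨x, hx, hxne⟩ := Submodule.exists_mem_ne_zero_of_ne_bot h1
    obtain ⟨y, hy, hyne⟩ := Submodule.exists_mem_ne_zero_of_ne_bot h2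
    have hz : x.1 • y = y.1 • x := Subtype.ext (mul_comm _ _)
    have h3 : x.1 • y = 0 := Submodule.disjoint_def.1 hpq.disjoint _
      (hz ▸ p.smul_mem _ hx) (q.smul_mem _ hy)
    have h4 : x.1 * y.1 = 0 := congrArg Subtype.val h3
    rcases mul_eq_zero.1 h4 with h | h
    · exact hxne (Subtype.ext h)
    · exact hyne (Subtype.ext h)
  · intro hproj
    obtain ⟨τ, hτ⟩ := Module.projective_lifting_property ρ LinearMap.id hρ
    obtain ⟨s1, -, h1⟩ := dual_rep hmm' 2 1 mx2 my1' mxm (hx0 _)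
      (LinearMap.fst R R R ∘ₗ τ ∘ₗ e.toLinearMap)
    obtain ⟨s2, -, h2⟩ := dual_rep hmm' 2 1 mx2 my1' mxm (hx0 _)
      (LinearMap.snd R R R ∘ₗ τ ∘ₗ e.toLinearMap)
    have h3 := LinearMap.congr_fun hτ (e ⟨_, mx2⟩)
    have h4 := congrArg (fun z : I => z.1.1) h3
    have h1' := h1 ⟨_, mx2⟩
    have h2' := h2 ⟨_, mx2⟩
    replace h4 : (τ (e ⟨_, mx2⟩)).1.1 * a.1 + (τ (e ⟨_, mx2⟩)).2.1 * b₁.1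
      = X 0 ^ (m - 2) * X 0 ^ 2 := h4
    replace h1' : (τ (e ⟨_, mx2⟩)).1.1 = s1 * X 0 ^ 2 := h1'
    replace h2' : (τ (e ⟨_, mx2⟩)).2.1 = s2 * X 0 ^ 2 := h2'
    rw [h1', h2', ha', hb] at h4
    have h5 : s1 * X 0 ^ 2 + s2 * X 1 = 1 := by
      apply mul_left_cancel₀ (mul_ne_zero (hx0 (m - 2)) (hx0 2))
      linear_combination h4
    have h6 := congrArg (constantCoeff (R := ℂ) (σ := Fin 2)) h5
    simp at h6
end
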